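/- Let K_xy ⊂ ℝ^{n+m} and K_yz ⊂ ℝ^{m+p} be compact, and assume K has nonempty interior. Suppose there exists a scalar N ∈ ℝ such that N − ‖(X,Y)‖² ∈ Q(g). If f ∈ ℝ[X,Y] + ℝ[Y,Z] and f(x,y,z) > 0 for all (x,y,z) ∈ K, then f ∈ Q(g) + P(h), i.e. f = σ + ψ for some σ ∈ Q(g) and ψ ∈ P(h). -/

import Mathlib

section frozen
open MvPolynomial

/-- A polynomial is a sum of squares. -/
def IsSOS {ι : Type*} (q : MvPolynomial ι ℝ) : Prop :=
  ∃ (k : ℕ) (s : Fin k → MvPolynomial ι ℝ), q = ∑ i, (s i) ^ 2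

/-- Membership in the preordering generated by a finite family `g`:
`σ = Σ_{J ⊆ I} σ_J ∏_{j ∈ J} g_j` with each `σ_J` a sum of squares. -/
def InPreordering {ι κ : Type*} [Fintype κ] [DecidableEq κ]
    (g : κ → MvPolynomial ι ℝ) (σ : MvPolynomial ι ℝ) : Prop :=
  ∃ c : Finset κ → MvPolynomial ι ℝ,
    (∀ J, IsSOS (c J)) ∧ σ = ∑ J : Finset κ, c J * ∏ j ∈ J, g j

/-- Membership in the quadratic module generated by a finite family `g`:
`σ = σ₀ + Σ_j σ_j g_j` with `σ₀` and each `σ_j` sums of squares. -/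
def InQuadraticModule {ι κ : Type*} [Fintype κ]
    (g : κ → MvPolynomial ι ℝ) (σ : MvPolynomial ι ℝ) : Prop :=
  ∃ (c₀ : MvPolynomial ι ℝ) (c : κ → MvPolynomial ι ℝ),
    IsSOS c₀ ∧ (∀ j, IsSOS (c j)) ∧ σ = c₀ + ∑ j, c j * g j

end frozen

section part1
open Polynomial

/-- Intermediate value property for polynomials over an ordered field. -/
def PolyIVT (F : Type*) [Field F] [LinearOrder F] : Prop :=
  ∀ (p : F[X]) (a b : F), a < b → p.eval a < 0 → 0 < p.eval b → ∃ c, a < c ∧ c < b ∧ p.eval c = 0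

section ivt
variable {F : Type*} [Field F] [LinearOrder F] [IsStrictOrderedRing F]

lemma PolyIVT.neg (hF : PolyIVT F) (p : F[X]) (a b : F) (hab : a < b) (ha : 0 < p.eval a)
    (hb : p.eval b < 0) : ∃ c, a < c ∧ c < b ∧ p.eval c = 0 := by
  obtain ⟨c, h1, h2, h3⟩ := hF (-p) a b hab (by simpa using ha) (by simpa using hb)
  exact ⟨c, h1, h2, by simpa using h3⟩

/-- No roots: constant sign. -/
lemma PolyIVT.sign_eq (hF : PolyIVT F) (p : F[X]) (a b : F)
    (h : ∀ c, min a b ≤ c → c ≤ max a b → p.eval c ≠ 0) :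
    SignType.sign (p.eval a) = SignType.sign (p.eval b) := by
  wlog hab : a ≤ b generalizing a b
  · exact (this b a (by simpa [min_comm, max_comm] using h) (le_of_not_ge hab)).symm
  rw [min_eq_left hab, max_eq_right hab] at h
  rcases hab.eq_or_lt with rfl | hab'
  · rfl
  rcases lt_or_gt_of_ne (h a le_rfl hab) with ha | ha <;>
  rcases lt_or_gt_of_ne (h b hab le_rfl) with hb | hb
  · rw [sign_neg ha, sign_neg hb]
  · obtain ⟨c, h1, h2, h3⟩ := hF p a b hab' ha hb
    exact absurd h3 (h c h1.le h2.le)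
  · obtain ⟨c, h1, h2, h3⟩ := hF.neg p a b hab' ha hb
    exact absurd h3 (h c h1.le h2.le)
  · rw [sign_pos ha, sign_pos hb]

lemma PolyIVT.mono_left (hF : PolyIVT F) (P : F[X]) (u v : F)
    (hP : ∀ x, u < x → x < v → 0 < P.derivative.eval x) (x : F) (hux : u < x) (hxv : x < v) :
    P.eval u < P.eval x := by
  have hne : P - C (P.eval u) ≠ 0 := by
    intro h0
    have : P = C (P.eval u) := by linear_combination h0
    have h1 := hP x hux hxv
    rw [this] at h1
    simp at h1
  obtain ⟨s, hs, hsu⟩ := Polynomial.exists_eq_pow_rootMultiplicity_mul_and_not_dvd _ hne u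
  set m := rootMultiplicity u (P - C (P.eval u)) with hm
  have hm0 : 0 < m := (rootMultiplicity_pos hne).2 (by simp)
  have hsu' : s.eval u ≠ 0 := by rwa [Ne, ← IsRoot.def, ← dvd_iff_isRoot]
  obtain ⟨k, hk⟩ : ∃ k, m = k + 1 := ⟨m - 1, by omega⟩
  rw [hk] at hs
  have hPeq : P = (X - C u) ^ (k+1) * s + C (P.eval u) := by linear_combination hs
  have hder : P.derivative = (X - C u) ^ k * ((k + 1 : F[X]) * s + (X - C u) * s.derivative) := by
    conv_lhs => rw [hPeq]
    simp [derivative_mul, derivative_pow]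
    ring
  set b : F[X] := (k + 1 : F[X]) * s + (X - C u) * s.derivative with hb
  have hbpos : ∀ y, u < y → y < v → 0 < b.eval y := by
    intro y h1 h2
    have h3 := hP y h1 h2
    rw [hder, eval_mul] at h3
    have h4 : 0 < ((X - C u) ^ k : F[X]).eval y := by
      simp; exact pow_pos (sub_pos.2 h1) _
    exact (pos_iff_pos_of_mul_pos h3).1 h4
  have hk1 : (0:F) < k + 1 := by positivity
  have hbu : b.eval u = (k + 1) * s.eval u := by simp [hb]
  have hspos : 0 < s.eval u := by
    by_contra hcon
    have hlt : s.eval u < 0 := lt_of_le_of_ne (not_lt.1 hcon) hsu'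
    have : b.eval u < 0 := by rw [hbu]; exact mul_neg_of_pos_of_neg hk1 hlt
    obtain ⟨c, h1, h2, h3⟩ := hF b u x hux this (hbpos x hux hxv)
    exact (hbpos c h1 (h2.trans hxv)).ne' h3
  have key : ∀ w, u < w → w < v → s.eval w ≠ 0 := by
    intro w0 hw0 hw0v hsw0
    have hs0 : s ≠ 0 := by rintro rfl; simp at hsu'
    obtain ⟨w, hw, hmin⟩ := Finset.exists_min_image
      (s.roots.toFinset.filter (fun w => u < w ∧ w < v)) id
      ⟨w0, by simp [hs0, hsw0, hw0, hw0v]⟩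
    simp only [Finset.mem_filter, Multiset.mem_toFinset, mem_roots hs0, IsRoot.def] at hw
    obtain ⟨hsw, huw, hwv⟩ := hw
    obtain ⟨t, ht⟩ := dvd_iff_isRoot.2 (show IsRoot s w from hsw)
    have hbw := hbpos w huw hwv
    have hb2 : b.eval w = (w - u) * t.eval w := by
      simp [hb, hsw]
      left
      rw [ht]; simp [derivative_mul]
    rw [hb2] at hbw
    have htw : 0 < t.eval w := (pos_iff_pos_of_mul_pos hbw).1 (sub_pos.2 huw)
    have htu : t.eval u < 0 := by
      have : s.eval u = (u - w) * t.eval u := by conv_lhs => rw [ht]; simp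
      rw [this] at hspos
      exact (neg_iff_neg_of_mul_pos hspos).1 (sub_neg.2 huw)
    obtain ⟨c, h1, h2, h3⟩ := hF t u w huw htu htw
    have := hmin c (by
      simp only [Finset.mem_filter, Multiset.mem_toFinset, mem_roots hs0, IsRoot.def]
      exact ⟨by rw [ht]; simp [h3], h1, h2.trans hwv⟩)
    exact absurd this (not_le.2 h2)
  have hsx : 0 < s.eval x := by
    rcases lt_trichotomy (s.eval x) 0 with h | h | h
    · obtain ⟨c, h1, h2, h3⟩ := hF.neg s u x hux hspos h
      exact absurd h3 (key c h1 (h2.trans hxv))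
    · exact absurd h (key x hux hxv)
    · exact h
  have : P.eval x = (x - u)^(k+1) * s.eval x + P.eval u := by
    conv_lhs => rw [hPeq]
    simp
  rw [this]
  have := mul_pos (pow_pos (sub_pos.2 hux) (k+1)) hsx
  linarith

lemma PolyIVT.mono_right (hF : PolyIVT F) (P : F[X]) (u v : F)
    (hP : ∀ x, u < x → x < v → 0 < P.derivative.eval x) (x : F) (hux : u < x) (hxv : x < v) :
    P.eval x < P.eval v := by
  have := hF.mono_left (-(P.comp (-X))) (-v) (-u) (by
    intro y h1 h2
    have := hP (-y) (by linarith) (by linarith)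
    simpa [derivative_comp] using this) (-x) (by linarith) (by linarith)
  simpa using this

lemma root_bound (p : F[X]) (hp : p.Monic) (x : F) (hx : p.eval x = 0) :
    |x| < 2 + ∑ i ∈ Finset.range p.natDegree, (1 + p.coeff i ^ 2) := by
  have hS : ∀ i, 0 ≤ 1 + p.coeff i ^ 2 := fun i => by positivity
  have hsum : 0 ≤ ∑ i ∈ Finset.range p.natDegree, (1 + p.coeff i ^ 2) :=
    Finset.sum_nonneg (fun i _ => hS i)
  by_cases h1 : |x| ≤ 1
  · linarith
  push Not at h1
  have hd : p.natDegree ≠ 0 := by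
    intro h0
    rw [hp.natDegree_eq_zero.1 h0] at hx
    simp at hx
  obtain ⟨k, hk⟩ := Nat.exists_eq_succ_of_ne_zero hd
  rw [eval_eq_sum_range, Finset.sum_range_succ, hp.coeff_natDegree, one_mul] at hx
  have h2 : |x| ^ p.natDegree ≤ ∑ i ∈ Finset.range p.natDegree, (1 + p.coeff i ^ 2) * |x| ^ k := by
    rw [← abs_pow, eq_neg_of_add_eq_zero_right hx, abs_neg]
    refine (Finset.abs_sum_le_sum_abs _ _).trans (Finset.sum_le_sum fun i hi => ?_)
    rw [abs_mul, abs_pow]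
    have : |p.coeff i| ≤ 1 + p.coeff i ^ 2 := by
      rw [abs_le]; constructor <;> nlinarith [sq_nonneg (p.coeff i - 1), sq_nonneg (p.coeff i + 1)]
    have hik : i ≤ k := by have := Finset.mem_range.1 hi; omega
    exact mul_le_mul this (pow_le_pow_right₀ h1.le hik) (by positivity) (hS i)
  rw [← Finset.sum_mul] at h2
  have h3 : |x| ^ p.natDegree = |x| * |x| ^ k := by rw [hk, pow_succ]; ring
  rw [h3] at h2
  have := le_of_mul_le_mul_right h2 (by positivity)
  linarith
end ivt
end part1

section part2
open Polynomial
set_option linter.unusedSectionVars false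

section partialIso
variable {k F H : Type*} [Field k] [Field F] [LinearOrder F] [IsStrictOrderedRing F]
  [Field H] [LinearOrder H] [IsStrictOrderedRing H]

/-- all roots of `g` (via `i`) come from `k`. -/
def RootsIn (i : k →+* F) (g : k[X]) : Prop :=
  ∀ x, g.eval₂ i x = 0 → ∃ c, i c = x

lemma sign_pos_iff' {i : k →+* F} {j : k →+* H}
    (hs : ∀ c, SignType.sign (i c) = SignType.sign (j c)) (c : k) : 0 < i c ↔ 0 < j c := by
  rw [← sign_eq_one_iff, ← sign_eq_one_iff, hs]

lemma sign_lt_iff' {i : k →+* F} {j : k →+* H}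
    (hs : ∀ c, SignType.sign (i c) = SignType.sign (j c)) (a b : k) : i a < i b ↔ j a < j b := by
  have := sign_pos_iff' hs (b - a)
  simpa using this

lemma cut_sign {i : k →+* F} {j : k →+* H} (hF : PolyIVT F) (hH : PolyIVT H)
    (hs : ∀ c, SignType.sign (i c) = SignType.sign (j c))
    (α : F) (β : H) (hab : ∀ c, SignType.sign (α - i c) = SignType.sign (β - j c))
    (n : ℕ) : ∀ (g : k[X]), g.natDegree = n → RootsIn i g → RootsIn j g →
    SignType.sign (g.eval₂ i α) = SignType.sign (g.eval₂ j β) := by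
  induction n with
  | zero =>
    intro g hg h1 h2
    rw [eq_C_of_natDegree_eq_zero hg]
    simp [hs]
  | succ n ih =>
    intro g hg h1 h2
    by_cases hr : ∃ c, g.eval c = 0
    · obtain ⟨c, hc⟩ := hr
      obtain ⟨q, hq⟩ := dvd_iff_isRoot.2 (show IsRoot g c from hc)
      have hg0 : g ≠ 0 := by rintro rfl; simp at hg
      have hq0 : q ≠ 0 := by rintro rfl; simp at hq; exact hg0 hq
      have hqd : q.natDegree = n := by
        have := congrArg natDegree hq
        rw [natDegree_mul (X_sub_C_ne_zero c) hq0, natDegree_X_sub_C] at this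
        omega
      have := ih q hqd (fun x hx => h1 x (by rw [hq, eval₂_mul, hx, mul_zero]))
        (fun x hx => h2 x (by rw [hq, eval₂_mul, hx, mul_zero]))
      rw [hq, eval₂_mul, eval₂_mul, sign_mul, sign_mul, this]
      simp [hab]
    · push Not at hr
      have e1 : ∀ x, g.eval₂ i x ≠ 0 := by
        intro x hx
        obtain ⟨c, rfl⟩ := h1 x hx
        rw [eval₂_hom] at hx
        exact hr c (by simpa using hx)
      have e2 : ∀ x, g.eval₂ j x ≠ 0 := by
        intro x hx
        obtain ⟨c, rfl⟩ := h2 x hx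
        rw [eval₂_hom] at hx
        exact hr c (by simpa using hx)
      have a1 := hF.sign_eq (g.map i) α (i 0) (fun c _ _ => by rw [eval_map]; exact e1 c)
      have a2 := hH.sign_eq (g.map j) β (j 0) (fun c _ _ => by rw [eval_map]; exact e2 c)
      rw [eval_map, eval_map, eval₂_hom] at a1 a2
      rw [a1, a2, hs]

lemma alg_step {i : k →+* F} {j : k →+* H} (hF : PolyIVT F) (hH : PolyIVT H)
    (hs : ∀ c, SignType.sign (i c) = SignType.sign (j c))
    (p : k[X]) (hp : p.Monic)
    (hlow : ∀ g : k[X], g ≠ 0 → g.natDegree < p.natDegree → RootsIn i g ∧ RootsIn j g)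
    (α : F) (hα : p.eval₂ i α = 0) (hαk : ∀ c, i c ≠ α) :
    ∃ β : H, ∀ g : k[X], SignType.sign (g.eval₂ i α) = SignType.sign (g.eval₂ j β) := by
  classical
  have hlt := sign_lt_iff' hs
  have hi2 : i 2 = 2 := map_ofNat i 2
  have : CharZero k := ⟨fun a b hab => by
    have : ((a : F)) = b := by have := congrArg i hab; simpa using this
    exact_mod_cast this⟩
  have hd : p.natDegree ≠ 0 := by
    intro h0
    rw [hp.natDegree_eq_zero.1 h0] at hα
    simp at hα
  have hder0 : p.derivative ≠ 0 := by
    intro h0; exact hd (derivative_eq_zero.1 h0)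
  have hderd : p.derivative.natDegree < p.natDegree := natDegree_derivative_lt hd
  -- suffices the cut version
  suffices hcut : ∃ β : H, p.eval₂ j β = 0 ∧
      ∀ c, SignType.sign (α - i c) = SignType.sign (β - j c) by
    obtain ⟨β, hβ, hab⟩ := hcut
    refine ⟨β, fun g => ?_⟩
    have h1 : g.eval₂ i α = (g %ₘ p).eval₂ i α := by
      conv_lhs => rw [← modByMonic_add_div g p]
      simp [hα]
    have h2 : g.eval₂ j β = (g %ₘ p).eval₂ j β := by
      conv_lhs => rw [← modByMonic_add_div g p]
      simp [hβ]
    rw [h1, h2]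
    by_cases h0 : g %ₘ p = 0
    · simp [h0]
    have := hlow _ h0 (natDegree_modByMonic_lt g hp (by rintro rfl; simp at hd))
    exact cut_sign hF hH hs α β hab _ _ rfl this.1 this.2
  have hpα : p.derivative.eval₂ i α ≠ 0 := by
    intro h
    obtain ⟨c, hc⟩ := (hlow _ hder0 hderd).1 α h
    exact hαk c hc
  -- sign normalisation
  obtain ⟨P, hP, hPpos⟩ : ∃ P : k[X], (P = p ∨ P = -p) ∧ 0 < P.derivative.eval₂ i α := by
    rcases lt_or_gt_of_ne hpα with h | h
    · exact ⟨-p, Or.inr rfl, by simpa using h⟩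
    · exact ⟨p, Or.inl rfl, h⟩
  have hPi : ∀ x, P.eval₂ i x = 0 ↔ p.eval₂ i x = 0 := by
    rcases hP with rfl | rfl <;> simp
  have hPj : ∀ x, P.eval₂ j x = 0 ↔ p.eval₂ j x = 0 := by
    rcases hP with rfl | rfl <;> simp
  have hDi : ∀ x, P.derivative.eval₂ i x = 0 → p.derivative.eval₂ i x = 0 := by
    rcases hP with rfl | rfl <;> simp
  have hDj : ∀ x, P.derivative.eval₂ j x = 0 → p.derivative.eval₂ j x = 0 := by
    rcases hP with rfl | rfl <;> simp
  set M : k := 2 + ∑ i ∈ Finset.range p.natDegree, (1 + p.coeff i ^ 2) with hM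
  have hMα : |α| < i M := by
    have := root_bound (p.map i) (hp.map i) α (by rwa [eval_map])
    simpa [hM, hp.natDegree_map, hi2] using this
  rw [abs_lt] at hMα
  have hDk : ∀ c, p.derivative.eval c = 0 ↔ p.derivative.eval₂ i (i c) = 0 := by
    intro c; rw [eval₂_hom]; simp
  set Rt : Finset k := p.derivative.roots.toFinset ∪ {M, -M} with hRt
  have hRtD : ∀ c, p.derivative.eval c = 0 → c ∈ Rt := by
    intro c hc; simp [hRt, hder0, hc]
  obtain ⟨l, hl, hlmax⟩ := Finset.exists_max_image (Rt.filter (fun c => i c < α)) i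
    ⟨-M, by simp [hRt]; linarith [hMα.1]⟩
  obtain ⟨r, hr, hrmin⟩ := Finset.exists_min_image (Rt.filter (fun c => α < i c)) i
    ⟨M, by simp [hRt]; linarith [hMα.2]⟩
  rw [Finset.mem_filter] at hl hr
  have hlα := hl.2
  have hαr := hr.2
  have noroot : ∀ c, i l < i c → i c < i r → P.derivative.eval c ≠ 0 := by
    intro c h1 h2 h3
    have h4 : p.derivative.eval c = 0 := by
      rcases hP with rfl | rfl
      · exact h3
      · simpa using h3
    rcases lt_or_gt_of_ne (hαk c) with h | h
    · exact absurd (hlmax c (Finset.mem_filter.2 ⟨hRtD c h4, h⟩)) (not_le.2 h1)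
    · exact absurd (hrmin c (Finset.mem_filter.2 ⟨hRtD c h4, h⟩)) (not_le.2 h2)
  have norooti : ∀ x, i l < x → x < i r → P.derivative.eval₂ i x ≠ 0 := by
    intro x h1 h2 h3
    obtain ⟨c, rfl⟩ := (hlow _ hder0 hderd).1 x (hDi x h3)
    rw [eval₂_hom] at h3
    exact noroot c h1 h2 (by simpa using h3)
  have norootj : ∀ x, j l < x → x < j r → P.derivative.eval₂ j x ≠ 0 := by
    intro x h1 h2 h3
    obtain ⟨c, rfl⟩ := (hlow _ hder0 hderd).2 x (hDj x h3)
    rw [eval₂_hom] at h3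
    exact noroot c ((hlt _ _).2 h1) ((hlt _ _).2 h2) (by simpa using h3)
  have posi : ∀ x, i l < x → x < i r → 0 < P.derivative.eval₂ i x := by
    intro x h1 h2
    have := hF.sign_eq (P.derivative.map i) α x (fun c hc1 hc2 => by
      rw [eval_map]
      exact norooti c (lt_of_lt_of_le (lt_min hlα h1) hc1) (lt_of_le_of_lt hc2 (max_lt hαr h2)))
    rw [eval_map, eval_map, sign_pos hPpos] at this
    exact sign_eq_one_iff.1 this.symm
  have hlr : i l < i r := hlα.trans hαr
  have hlrj : j l < j r := (hlt _ _).1 hlr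
  set mid : k := (l + r) / 2 with hmid
  have hm1 : i l < i mid := by simp [hmid, hi2]; linarith
  have hm2 : i mid < i r := by simp [hmid, hi2]; linarith
  have posmid : 0 < P.derivative.eval₂ j (j mid) := by
    have := posi _ hm1 hm2
    rw [eval₂_hom] at this ⊢
    exact (sign_pos_iff' hs _).1 this
  have posj : ∀ x, j l < x → x < j r → 0 < P.derivative.eval₂ j x := by
    intro x h1 h2
    have := hH.sign_eq (P.derivative.map j) (j mid) x (fun c hc1 hc2 => by
      rw [eval_map]
      exact norootj c (lt_of_lt_of_le (lt_min ((hlt _ _).1 hm1) h1) hc1)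
        (lt_of_le_of_lt hc2 (max_lt ((hlt _ _).1 hm2) h2)))
    rw [eval_map, eval_map, sign_pos posmid] at this
    exact sign_eq_one_iff.1 this.symm
  -- monotonicity
  have monoi : ∀ x y, i l ≤ x → x < y → y ≤ i r → (x ≠ i l ∨ y ≠ i r) →
      P.eval₂ i x < P.eval₂ i y := by
    intro x y h1 h2 h3 h4
    rw [← eval_map, ← eval_map]
    rcases h4 with h4 | h4
    · exact hF.mono_right (P.map i) (i l) y (fun z hz1 hz2 => by
        rw [derivative_map, eval_map]; exact posi z hz1 (hz2.trans_le h3)) x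
        (lt_of_le_of_ne h1 h4.symm) h2
    · exact hF.mono_left (P.map i) x (i r) (fun z hz1 hz2 => by
        rw [derivative_map, eval_map]; exact posi z (h1.trans_lt hz1) hz2) y h2
        (lt_of_le_of_ne h3 h4)
  have monoj : ∀ x y, j l < x → x < y → y < j r → P.eval₂ j x < P.eval₂ j y := by
    intro x y h1 h2 h3
    rw [← eval_map, ← eval_map]
    exact hH.mono_left (P.map j) x (j r) (fun z hz1 hz2 => by
        rw [derivative_map, eval_map]; exact posj z (h1.trans hz1) hz2) y h2 h3
  have hPα : P.eval₂ i α = 0 := (hPi α).2 hα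
  have negl : P.eval₂ i (i l) < 0 := by
    rw [← hPα]; exact monoi _ _ le_rfl hlα hαr.le (Or.inr hαr.ne)
  have posr : 0 < P.eval₂ i (i r) := by
    rw [← hPα]; exact monoi _ _ hlα.le hαr le_rfl (Or.inl hlα.ne')
  have signk : ∀ c, (P.eval₂ i (i c) < 0 ↔ P.eval₂ j (j c) < 0) ∧
      (0 < P.eval₂ i (i c) ↔ 0 < P.eval₂ j (j c)) := by
    intro c
    rw [eval₂_hom, eval₂_hom]
    exact ⟨by rw [← sign_eq_neg_one_iff, ← sign_eq_neg_one_iff, hs], sign_pos_iff' hs _⟩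
  obtain ⟨β, hβ1, hβ2, hβ⟩ := hH (P.map j) (j l) (j r) hlrj
    (by rw [eval_map]; exact (signk l).1.1 negl) (by rw [eval_map]; exact (signk r).2.1 posr)
  rw [eval_map] at hβ
  refine ⟨β, (hPj β).1 hβ, fun c => ?_⟩
  rcases lt_or_gt_of_ne (hαk c) with h | h
  · rw [sign_pos (sub_pos.2 h), sign_pos]
    rw [sub_pos]
    by_cases h1 : i l < i c
    · have h2 : P.eval₂ j (j c) < 0 := by
        rw [← (signk c).1, ← hPα]
        exact monoi _ _ h1.le h hαr.le (Or.inl h1.ne')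
      by_contra hcon
      rcases (not_lt.1 hcon).eq_or_lt with h3 | h3
      · rw [← h3, hβ] at h2; exact lt_irrefl _ h2
      · have := monoj β (j c) hβ1 h3 ((hlt _ _).1 (h.trans hαr))
        rw [hβ] at this; exact lt_asymm this h2
    · have : ¬ j l < j c := fun h2 => h1 ((hlt _ _).2 h2)
      exact lt_of_le_of_lt (not_lt.1 this) hβ1
  · rw [sign_neg (sub_neg.2 h), sign_neg]
    rw [sub_neg]
    by_cases h1 : i c < i r
    · have h2 : 0 < P.eval₂ j (j c) := by
        rw [← (signk c).2, ← hPα]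
        exact monoi _ _ hlα.le h h1.le (Or.inr h1.ne)
      by_contra hcon
      rcases (not_lt.1 hcon).eq_or_lt with h3 | h3
      · rw [h3, hβ] at h2; exact lt_irrefl _ h2
      · have := monoj (j c) β ((hlt _ _).1 (hlα.trans h)) h3 hβ2
        rw [hβ] at this; exact lt_asymm this h2
    · have : ¬ j c < j r := fun h2 => h1 ((hlt _ _).2 h2)
      exact lt_of_lt_of_le hβ2 (not_lt.1 this)
end partialIso
end part2

section part3
open Polynomial
set_option linter.unusedSectionVars false

section embed
variable {F H : Type*} [Field F] [LinearOrder F] [IsStrictOrderedRing F]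
  [Field H] [LinearOrder H] [IsStrictOrderedRing H]

/-- A partial order isomorphism between subrings of `F` and `H`. -/
def GoodSub (Γ : Subring (F × H)) : Prop :=
  ∀ z ∈ Γ, SignType.sign z.1 = SignType.sign z.2

/-- countable saturation of the order -/
def CSat (H : Type*) [LinearOrder H] : Prop :=
  ∀ (A B : Set H), A.Countable → B.Countable → (∀ a ∈ A, ∀ b ∈ B, a < b) →
    ∃ t, (∀ a ∈ A, a < t) ∧ ∀ b ∈ B, t < b

lemma GoodSub.adjoin {Γ : Subring (F × H)} (hmax : ∀ Γ' : Subring (F × H), GoodSub Γ' → Γ ≤ Γ' → Γ' ≤ Γ)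
    (α : F) (β : H)
    (h : ∀ g : Γ[X], SignType.sign (g.eval₂ ((RingHom.fst F H).comp Γ.subtype) α) =
      SignType.sign (g.eval₂ ((RingHom.snd F H).comp Γ.subtype) β)) : (α, β) ∈ Γ := by
  set φ : Γ[X] →+* F × H := eval₂RingHom Γ.subtype (α, β) with hφ
  have hg : GoodSub φ.range := by
    rintro z ⟨g, rfl⟩
    have h1 : (φ g).1 = g.eval₂ ((RingHom.fst F H).comp Γ.subtype) α := by
      have := hom_eval₂ g Γ.subtype (RingHom.fst F H) (α, β)
      simpa [hφ] using this
    have h2 : (φ g).2 = g.eval₂ ((RingHom.snd F H).comp Γ.subtype) β := by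
      have := hom_eval₂ g Γ.subtype (RingHom.snd F H) (α, β)
      simpa [hφ] using this
    rw [h1, h2, h]
  refine hmax _ hg ?_ ⟨X, by simp [hφ]⟩
  intro z hz
  exact ⟨C ⟨z, hz⟩, by simp [hφ]⟩

lemma GoodSub.ne_zero_iff {Γ : Subring (F × H)} (hΓ : GoodSub Γ) {z : F × H} (hz : z ∈ Γ) :
    z.1 = 0 ↔ z.2 = 0 := by
  rw [← sign_eq_zero_iff (a := z.1), ← sign_eq_zero_iff (a := z.2), hΓ z hz]

/-- fraction extension -/
def fracSub (Γ : Subring (F × H)) : Subring (F × H) where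
  carrier := {z | ∃ u ∈ Γ, u.1 ≠ 0 ∧ u * z ∈ Γ}
  mul_mem' := by
    rintro a b ⟨u, hu, hu0, hua⟩ ⟨v, hv, hv0, hvb⟩
    exact ⟨u * v, mul_mem hu hv, by simp [hu0, hv0], by
      have := mul_mem hua hvb
      rwa [mul_mul_mul_comm] at this⟩
  one_mem' := ⟨1, one_mem _, by simp, by simp⟩
  add_mem' := by
    rintro a b ⟨u, hu, hu0, hua⟩ ⟨v, hv, hv0, hvb⟩
    exact ⟨u * v, mul_mem hu hv, by simp [hu0, hv0], by
      have := add_mem (mul_mem hv hua) (mul_mem hu hvb)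
      convert this using 1; ring⟩
  zero_mem' := ⟨1, one_mem _, by simp, by simp⟩
  neg_mem' := by
    rintro a ⟨u, hu, hu0, hua⟩
    exact ⟨u, hu, hu0, by simpa using neg_mem hua⟩

lemma fracSub_good (Γ : Subring (F × H)) (hΓ : GoodSub Γ) : GoodSub (fracSub Γ) := by
  rintro z ⟨u, hu, hu0, huz⟩
  have h1 := hΓ _ huz
  have h2 := hΓ _ hu
  simp only [Prod.fst_mul, Prod.snd_mul, sign_mul, h2] at h1
  have h3 : SignType.sign u.2 ≠ 0 := by rw [← h2]; simpa using hu0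
  exact mul_left_cancel₀ h3 h1

theorem embed_exists [Countable F] (hF : PolyIVT F) (hH : PolyIVT H) (hsat : CSat H)
    (Γ₀ : Subring (F × H)) (h₀ : GoodSub Γ₀) :
    ∃ Γ : Subring (F × H), Γ₀ ≤ Γ ∧ GoodSub Γ ∧ ∀ α, ∃ β, (α, β) ∈ Γ := by
  obtain ⟨Γ, hle, hmx⟩ := zorn_le_nonempty₀ {Γ : Subring (F × H) | GoodSub Γ} (by
    intro c hc hch y hy
    refine ⟨sSup c, ?_, fun z hz => le_sSup hz⟩
    intro z hz
    rw [Subring.mem_sSup_of_directedOn ⟨y, hy⟩ hch.directedOn] at hz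
    obtain ⟨s, hs, hzs⟩ := hz
    exact hc hs z hzs) Γ₀ h₀
  have hΓ : GoodSub Γ := hmx.prop
  have hmax : ∀ Γ' : Subring (F × H), GoodSub Γ' → Γ ≤ Γ' → Γ' ≤ Γ :=
    fun Γ' h1 h2 => hmx.le_of_ge h1 h2
  refine ⟨Γ, hle, hΓ, ?_⟩
  have hfr : fracSub Γ ≤ Γ := hmax _ (fracSub_good Γ hΓ)
    (fun z hz => ⟨1, one_mem _, by simp, by simpa using hz⟩)
  have hfield : IsField Γ := by
    refine ⟨⟨0, 1, fun h => ?_⟩, mul_comm, ?_⟩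
    · have := congrArg (fun z : Γ => z.1.1) h
      simp at this
    · rintro ⟨z, hz⟩ hz0
      have hz1 : z.1 ≠ 0 := by
        intro h; apply hz0
        ext
        · exact h
        · exact (hΓ.ne_zero_iff hz).1 h
      have hz2 : z.2 ≠ 0 := fun h => hz1 ((hΓ.ne_zero_iff hz).2 h)
      have e : z * (z.1⁻¹, z.2⁻¹) = 1 := by ext <;> simp [hz1, hz2]
      exact ⟨⟨(z.1⁻¹, z.2⁻¹), hfr ⟨z, hz, hz1, by rw [e]; exact one_mem _⟩⟩, Subtype.ext e⟩
  letI : Field Γ := hfield.toField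
  set i : Γ →+* F := (RingHom.fst F H).comp Γ.subtype with hi
  set j : Γ →+* H := (RingHom.snd F H).comp Γ.subtype with hj
  have hs : ∀ c, SignType.sign (i c) = SignType.sign (j c) := fun c => hΓ c.1 c.2
  have hclosed : ∀ (n : ℕ) (g : Γ[X]), g ≠ 0 → g.natDegree = n → RootsIn i g ∧ RootsIn j g := by
    intro n
    induction n using Nat.strong_induction_on with
    | _ n ih =>
    intro g hg hgn
    set p := g * C g.leadingCoeff⁻¹ with hp
    have hpm : p.Monic := monic_mul_leadingCoeff_inv hg
    have hpd : p.natDegree = g.natDegree := natDegree_mul_leadingCoeff_inv g hg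
    have hlow : ∀ q : Γ[X], q ≠ 0 → q.natDegree < p.natDegree → RootsIn i q ∧ RootsIn j q :=
      fun q hq hqd => ih _ (by omega) q hq rfl
    constructor
    · intro α hα
      by_contra hcon
      push Not at hcon
      obtain ⟨β, hβ⟩ := alg_step hF hH hs p hpm hlow α (by rw [hp, eval₂_mul, hα, zero_mul]) hcon
      exact hcon ⟨_, GoodSub.adjoin hmax α β hβ⟩ rfl
    · intro β hβ
      by_contra hcon
      push Not at hcon
      obtain ⟨α, hα⟩ := alg_step hH hF (fun c => (hs c).symm) p hpm
        (fun q h1 h2 => (hlow q h1 h2).symm) β (by rw [hp, eval₂_mul, hβ, zero_mul]) hcon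
      exact hcon ⟨_, GoodSub.adjoin hmax α β (fun g => (hα g).symm)⟩ rfl
  intro α
  by_contra hcon
  push Not at hcon
  have hinj : Function.Injective i := i.injective
  have : Countable Γ := hinj.countable
  have hαk : ∀ c, i c ≠ α := by
    intro c hc
    exact hcon c.1.2 (by rw [← hc]; exact c.2)
  obtain ⟨β, hβ1, hβ2⟩ := hsat (j '' {c | i c < α}) (j '' {c | α < i c})
    ((Set.to_countable {c | i c < α}).image j) ((Set.to_countable {c | α < i c}).image j) (by
      rintro _ ⟨a, ha, rfl⟩ _ ⟨b, hb, rfl⟩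
      exact (sign_lt_iff' hs a b).1 (lt_trans ha hb))
  refine hcon β (GoodSub.adjoin hmax α β fun g => ?_)
  by_cases hg : g = 0
  · simp [hg]
  refine cut_sign hF hH hs α β (fun c => ?_) _ g rfl (hclosed _ g hg rfl).1 (hclosed _ g hg rfl).2
  rcases lt_or_gt_of_ne (hαk c) with h | h
  · rw [sign_pos (sub_pos.2 h), sign_pos (sub_pos.2 (hβ1 _ ⟨c, h, rfl⟩))]
  · rw [sign_neg (sub_neg.2 h), sign_neg (sub_neg.2 (hβ2 _ ⟨c, h, rfl⟩))]

end embed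
end part3

section part4
open Polynomial Filter

/-- the hyperreals, as a plain ultrapower -/
abbrev HR : Type := Germ (hyperfilter ℕ : Filter ℕ) ℝ

lemma HR_exists_rep (x : HR) : ∃ u : ℕ → ℝ, x = (u : HR) := by
  induction x using Germ.inductionOn with
  | _ f => exact ⟨f, rfl⟩

lemma HR_eval (p : HR[X]) : ∃ P : ℕ → ℝ[X], ∀ x : ℕ → ℝ,
    p.eval (x : HR) = ((fun n => (P n).eval (x n) : ℕ → ℝ) : HR) := by
  choose c hc using fun i => HR_exists_rep (p.coeff i)
  refine ⟨fun n => ∑ i ∈ Finset.range (p.natDegree + 1), C (c i n) * X ^ i, fun x => ?_⟩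
  have : (fun n => (∑ i ∈ Finset.range (p.natDegree + 1), C (c i n) * X ^ i : ℝ[X]).eval (x n))
      = ∑ i ∈ Finset.range (p.natDegree + 1), c i * x ^ i := by
    ext n
    simp [eval_finset_sum]
  rw [this, eval_eq_sum_range]
  have h2 := map_sum (Germ.coeRingHom (R := ℝ) (hyperfilter ℕ : Filter ℕ)) (fun i => c i * x ^ i)
    (Finset.range (p.natDegree + 1))
  simp only [map_mul, map_pow] at h2
  simp only [Germ.coe_coeRingHom] at h2
  rw [show ((∑ i ∈ Finset.range (p.natDegree + 1), c i * x ^ i : ℕ → ℝ) : HR) = _ from h2]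
  exact Finset.sum_congr rfl fun i _ => by rw [hc]

lemma HR_ivt : PolyIVT HR := by
  intro p a b hab ha hb
  obtain ⟨P, hP⟩ := HR_eval p
  obtain ⟨a, rfl⟩ := HR_exists_rep a
  obtain ⟨b, rfl⟩ := HR_exists_rep b
  rw [hP] at ha hb
  have hab' : ∀ᶠ n in (hyperfilter ℕ : Filter ℕ), a n < b n := Germ.coe_lt.1 hab
  have ha' : ∀ᶠ n in (hyperfilter ℕ : Filter ℕ), (P n).eval (a n) < 0 := Germ.coe_lt.1 ha
  have hb' : ∀ᶠ n in (hyperfilter ℕ : Filter ℕ), 0 < (P n).eval (b n) := Germ.coe_lt.1 hb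
  have : ∀ n, ∃ c, (a n < b n ∧ (P n).eval (a n) < 0 ∧ 0 < (P n).eval (b n)) →
      a n < c ∧ c < b n ∧ (P n).eval c = 0 := by
    intro n
    by_cases h : a n < b n ∧ (P n).eval (a n) < 0 ∧ 0 < (P n).eval (b n)
    · obtain ⟨h1, h2, h3⟩ := h
      obtain ⟨c, hc, hc0⟩ := intermediate_value_Ioo h1.le (P n).continuous.continuousOn ⟨h2, h3⟩
      exact ⟨c, fun _ => ⟨hc.1, hc.2, hc0⟩⟩
    · exact ⟨0, fun h' => absurd h' h⟩
  choose c hc using this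
  refine ⟨(c : HR), ?_, ?_, ?_⟩
  · rw [Germ.coe_lt]
    filter_upwards [hab', ha', hb'] with n h1 h2 h3 using (hc n ⟨h1, h2, h3⟩).1
  · rw [Germ.coe_lt]
    filter_upwards [hab', ha', hb'] with n h1 h2 h3 using (hc n ⟨h1, h2, h3⟩).2.1
  · rw [hP]
    refine Germ.coe_eq.2 ?_
    filter_upwards [hab', ha', hb'] with n h1 h2 h3 using (hc n ⟨h1, h2, h3⟩).2.2

lemma HR_sat_aux (Q : ℕ → ℕ → ℝ → Prop)
    (hQ : ∀ N, ∀ᶠ n in (hyperfilter ℕ : Filter ℕ), ∃ t, ∀ i < N, Q i n t) :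
    ∃ t : ℕ → ℝ, ∀ i, ∀ᶠ n in (hyperfilter ℕ : Filter ℕ), Q i n (t n) := by
  classical
  let Pr : ℕ → ℕ → Prop := fun n N => ∃ t, ∀ i < N, Q i n t
  have h0 : ∀ n, Pr n (Nat.findGreatest (Pr n) n) := fun n =>
    Nat.findGreatest_spec (P := Pr n) (Nat.zero_le n) ⟨0, by simp⟩
  choose t ht using h0
  refine ⟨t, fun i => ?_⟩
  have hev : ∀ᶠ n in (hyperfilter ℕ : Filter ℕ), i + 1 ≤ n :=
    (Nat.cofinite_eq_atTop ▸ hyperfilter_le_cofinite : (hyperfilter ℕ : Filter ℕ) ≤ atTop)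
      (eventually_ge_atTop (i + 1))
  filter_upwards [hev, hQ (i + 1)] with n h1 h2
  exact ht n i (Nat.le_findGreatest (P := Pr n) h1 h2)

lemma HR_sat : CSat HR := by
  classical
  intro A B hA hB hAB
  choose rep hrep using HR_exists_rep
  -- enumerate `A ∪ B ∪ {0}`
  obtain ⟨e, he⟩ := ((hA.union hB).insert (0 : HR)).exists_eq_range ⟨0, by simp⟩
  have hcov : ∀ x ∈ A ∪ B, ∃ i, e i = x := by
    intro x hx
    have : x ∈ Set.range e := by rw [← he]; exact Set.mem_insert_of_mem _ hx
    exact this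
  obtain ⟨t, ht⟩ := HR_sat_aux (fun i n t => (e i ∈ A → rep (e i) n < t) ∧
      (e i ∈ B → t < rep (e i) n)) (by
    intro N
    have h1 : ∀ᶠ n in (hyperfilter ℕ : Filter ℕ), ∀ i ∈ Finset.range N, ∀ j ∈ Finset.range N,
        e i ∈ A → e j ∈ B → rep (e i) n < rep (e j) n := by
      rw [Filter.eventually_all_finset]
      intro i _
      rw [Filter.eventually_all_finset]
      intro j _
      by_cases hi : e i ∈ A
      · by_cases hj : e j ∈ B
        · have := hAB _ hi _ hj
          rw [hrep (e i), hrep (e j)] at this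
          filter_upwards [Germ.coe_lt.1 this] with n hn _ _ using hn
        · exact Eventually.of_forall fun n _ h => absurd h hj
      · exact Eventually.of_forall fun n h => absurd h hi
    filter_upwards [h1] with n hn
    obtain ⟨t, ht1, ht2⟩ := Order.exists_between_finsets
      (((Finset.range N).filter (fun i => e i ∈ A)).image (fun i => rep (e i) n))
      (((Finset.range N).filter (fun i => e i ∈ B)).image (fun i => rep (e i) n)) (by
        intro x hx y hy
        simp only [Finset.mem_image, Finset.mem_filter] at hx hy
        obtain ⟨i, ⟨hi, hiA⟩, rfl⟩ := hx
        obtain ⟨j, ⟨hj, hjB⟩, rfl⟩ := hy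
        exact hn i hi j hj hiA hjB)
    refine ⟨t, fun i hi => ⟨fun h => ht1 _ ?_, fun h => ht2 _ ?_⟩⟩
    · exact Finset.mem_image.2 ⟨i, by simp [hi, h], rfl⟩
    · exact Finset.mem_image.2 ⟨i, by simp [hi, h], rfl⟩)
  refine ⟨(t : HR), fun a ha => ?_, fun b hb => ?_⟩
  · obtain ⟨i, rfl⟩ := hcov a (Or.inl ha)
    rw [hrep (e i), Germ.coe_lt]
    filter_upwards [ht i] with n hn
    exact hn.1 ha
  · obtain ⟨i, rfl⟩ := hcov b (Or.inr hb)
    rw [hrep (e i), Germ.coe_lt]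
    filter_upwards [ht i] with n hn
    exact hn.2 hb

/-- the constant embedding -/
noncomputable def HRc : ℝ →+* HR :=
  (Germ.coeRingHom (R := ℝ) (hyperfilter ℕ : Filter ℕ)).comp (Pi.constRingHom ℕ ℝ)

lemma HR_mveval {σ : Type*} (y : σ → ℕ → ℝ) (p : MvPolynomial σ ℝ) :
    MvPolynomial.eval₂ HRc (fun v => (y v : HR)) p =
      ((fun n => MvPolynomial.eval (fun v => y v n) p : ℕ → ℝ) : HR) := by
  induction p using MvPolynomial.induction_on with
  | C a => simp [HRc]; rfl
  | add p q hp hq => simp [hp, hq]; rfl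
  | mul_X p v hp => simp [hp]; rfl

lemma HRc_sign (c : ℝ) : SignType.sign (HRc c) = SignType.sign c := by
  have hpos : ∀ c : ℝ, 0 < c → 0 < HRc c := by
    intro c hc
    exact Germ.coe_lt.2 (Eventually.of_forall fun n => hc)
  rcases lt_trichotomy c 0 with h | h | h
  · rw [sign_neg h, sign_neg]
    have := hpos (-c) (by linarith)
    simpa using this
  · simp [h]
  · rw [sign_pos h, sign_pos (hpos c h)]
end part4

section part5
open Polynomial

section wsos
variable {K : Type*} [Field K] [LinearOrder K] [IsStrictOrderedRing K]

/-- weighted sums of squares of polynomials -/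
noncomputable def WSos (K : Type*) [Field K] [LinearOrder K] : AddSubmonoid K[X] :=
  AddSubmonoid.closure {w : K[X] | ∃ (c : K) (g : K[X]), 0 ≤ c ∧ w = C c * g ^ 2}

lemma sc_factor (a b : K) (p : K[X]) : p.eval a * p.eval b < 0 →
    ∃ q, Irreducible q ∧ q ∣ p ∧ q.eval a * q.eval b < 0 := by
  induction p using WfDvdMonoid.induction_on_irreducible with
  | zero => simp
  | unit u hu =>
    intro h
    obtain ⟨c, hc, rfl⟩ := Polynomial.isUnit_iff.1 hu
    simp at h
    exact absurd h (not_lt.2 (mul_self_nonneg c))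
  | mul p i hp hi ih =>
    intro h
    by_cases h1 : i.eval a * i.eval b < 0
    · exact ⟨i, hi, Dvd.intro _ rfl, h1⟩
    · have h2 : p.eval a * p.eval b < 0 := by
        rw [eval_mul, eval_mul] at h
        by_contra h3
        have := mul_nonneg (not_lt.1 h1) (not_lt.1 h3)
        linarith
      obtain ⟨q, hq, hqp, hs⟩ := ih h2
      exact ⟨q, hq, hqp.mul_left i, hs⟩

lemma WSos_reduce (q : K[X]) (hq : q ≠ 0) (hqd : q.natDegree ≠ 0) (w : K[X]) (hw : w ∈ WSos K) :
    ∃ w' ∈ WSos K, q ∣ w - w' ∧ w'.natDegree ≤ 2 * (q.natDegree - 1) ∧ ∀ x, 0 ≤ w'.eval x := by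
  induction hw using AddSubmonoid.closure_induction with
  | mem w h =>
    obtain ⟨c, g, hc, rfl⟩ := h
    refine ⟨C c * (g % q) ^ 2, AddSubmonoid.subset_closure ⟨c, _, hc, rfl⟩, ?_, ?_, ?_⟩
    · have : C c * g ^ 2 - C c * (g % q) ^ 2 = q * (C c * (g / q) * (g + g % q)) := by
        have := EuclideanDomain.div_add_mod g q
        linear_combination (-(C c) * (g + g % q)) * this
      exact ⟨_, this⟩
    · refine (natDegree_C_mul_le _ _).trans (natDegree_pow_le.trans ?_)
      have := natDegree_mod_lt g hqd
      omega
    · intro x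
      simp
      positivity
  | zero => exact ⟨0, zero_mem _, by simp, by simp, by simp⟩
  | add x y hx hy ihx ihy =>
    obtain ⟨x', hx', h1, h2, h3⟩ := ihx
    obtain ⟨y', hy', k1, k2, k3⟩ := ihy
    refine ⟨x' + y', add_mem hx' hy', ?_, ?_, ?_⟩
    · have := dvd_add h1 k1
      convert this using 1; ring
    · exact (natDegree_add_le _ _).trans (max_le h2 k2)
    · intro z; rw [eval_add]; exact add_nonneg (h3 z) (k3 z)

lemma no_dvd (a b : K) (n : ℕ) : ∀ (q : K[X]), q.natDegree = n → Irreducible q →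
    q.eval a * q.eval b < 0 → ∀ w ∈ WSos K, ¬ q ∣ 1 + w := by
  induction n using Nat.strong_induction_on with
  | _ n ih =>
  intro q hqn hq hs w hw hdvd
  have hqd : q.natDegree ≠ 0 := hq.natDegree_pos.ne'
  obtain ⟨w', hw', h1, h2, h3⟩ := WSos_reduce q hq.ne_zero hqd w hw
  have hd' : q ∣ 1 + w' := by
    have := dvd_sub hdvd h1
    convert this using 1; ring
  obtain ⟨s, hs'⟩ := hd'
  have ea : 0 < q.eval a * s.eval a := by
    rw [← eval_mul, ← hs']; simp; linarith [h3 a]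
  have eb : 0 < q.eval b * s.eval b := by
    rw [← eval_mul, ← hs']; simp; linarith [h3 b]
  have es : s.eval a * s.eval b < 0 := by
    have := mul_pos ea eb
    by_contra hcon
    have := mul_nonpos_of_nonpos_of_nonneg hs.le (not_lt.1 hcon)
    linarith
  have hs0 : s ≠ 0 := by rintro rfl; simp at ea
  obtain ⟨q', hq', hq's, hsc⟩ := sc_factor a b s es
  have hdeg : q'.natDegree < n := by
    have e1 : q'.natDegree ≤ s.natDegree := natDegree_le_of_dvd hq's hs0
    have e2 : (q * s).natDegree = q.natDegree + s.natDegree := natDegree_mul hq.ne_zero hs0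
    have e3 : (1 + w').natDegree ≤ 2 * (q.natDegree - 1) :=
      (natDegree_add_le _ _).trans (max_le (by simp) h2)
    rw [hs', e2] at e3
    omega
  exact ih _ hdeg q' rfl hq' hsc w' hw' (hs' ▸ hq's.mul_left q)
end wsos

section rcf
variable {Ω : Type*} [Field Ω]

/-- `C` is a preordering of the subfield `K`. -/
structure OrdPair (K : Subfield Ω) (C : Set Ω) : Prop where
  sub : ∀ x ∈ C, x ∈ K
  add : ∀ x ∈ C, ∀ y ∈ C, x + y ∈ C
  mul : ∀ x ∈ C, ∀ y ∈ C, x * y ∈ C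
  sq : ∀ x ∈ K, x * x ∈ C
  neg : (-1 : Ω) ∉ C

lemma OrdPair.anti {K : Subfield Ω} {C : Set Ω} (h : OrdPair K C) (x : Ω) (hx : x ∈ C)
    (hnx : -x ∈ C) : x = 0 := by
  by_contra h0
  apply h.neg
  have := h.mul _ (h.mul _ hnx _ hx) _ (h.sq x⁻¹ (inv_mem (h.sub x hx)))
  convert this using 1
  field_simp

lemma exists_max_pair (K₀ : Subfield Ω) (C₀ : Set Ω) (h₀ : OrdPair K₀ C₀) :
    ∃ K C, OrdPair K C ∧ K₀ ≤ K ∧ C₀ ⊆ C ∧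
      ∀ K' C', OrdPair K' C' → K ≤ K' → C ⊆ C' → K' ≤ K ∧ C' ⊆ C := by
  obtain ⟨⟨K, C⟩, hle, hmx⟩ := zorn_le_nonempty₀ {P : Subfield Ω × Set Ω | OrdPair P.1 P.2} (by
    intro c hc hch y hy
    have hdir : DirectedOn (· ≤ ·) (Prod.fst '' c) := by
      rintro _ ⟨a, ha, rfl⟩ _ ⟨b, hb, rfl⟩
      rcases hch.total ha hb with h | h
      · exact ⟨b.1, ⟨b, hb, rfl⟩, h.1, le_rfl⟩
      · exact ⟨a.1, ⟨a, ha, rfl⟩, le_rfl, h.1⟩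
    have key : ∀ x ∈ ⋃ P ∈ c, P.2, ∀ y ∈ ⋃ P ∈ c, P.2, ∃ P ∈ c, x ∈ P.2 ∧ y ∈ P.2 := by
      intro x hx y hy
      simp only [Set.mem_iUnion] at hx hy
      obtain ⟨P, hP, hx⟩ := hx
      obtain ⟨Q, hQ, hy⟩ := hy
      rcases hch.total hP hQ with h | h
      · exact ⟨Q, hQ, h.2 hx, hy⟩
      · exact ⟨P, hP, hx, h.2 hy⟩
    refine ⟨(sSup (Prod.fst '' c), ⋃ P ∈ c, P.2), ⟨?_, ?_, ?_, ?_, ?_⟩, ?_⟩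
    · intro x hx
      simp only [Set.mem_iUnion] at hx
      obtain ⟨P, hP, hx⟩ := hx
      exact (le_sSup (Set.mem_image_of_mem _ hP) : P.1 ≤ sSup (Prod.fst '' c)) ((hc hP).sub x hx)
    · intro x hx y hy
      obtain ⟨P, hP, h1, h2⟩ := key x hx y hy
      exact Set.mem_biUnion hP ((hc hP).add _ h1 _ h2)
    · intro x hx y hy
      obtain ⟨P, hP, h1, h2⟩ := key x hx y hy
      exact Set.mem_biUnion hP ((hc hP).mul _ h1 _ h2)
    · intro x hx
      simp only at hx
      rw [Subfield.mem_sSup_of_directedOn (Set.Nonempty.image _ ⟨y, hy⟩) hdir] at hx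
      obtain ⟨_, ⟨P, hP, rfl⟩, hx⟩ := hx
      exact Set.mem_biUnion hP ((hc hP).sq _ hx)
    · intro hx
      simp only [Set.mem_iUnion] at hx
      obtain ⟨P, hP, hx⟩ := hx
      exact (hc hP).neg hx
    · intro P hP
      exact ⟨le_sSup (Set.mem_image_of_mem _ hP), Set.subset_biUnion_of_mem (u := fun P : Subfield Ω × Set Ω => P.2) hP⟩) (K₀, C₀) h₀
  refine ⟨K, C, hmx.prop, hle.1, hle.2, fun K' C' h h1 h2 => ?_⟩
  have : (K', C') ≤ (K, C) := hmx.le_of_ge (y := (K', C')) h ⟨h1, h2⟩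
  exact ⟨this.1, this.2⟩

lemma max_total {K : Subfield Ω} {C : Set Ω} (h : OrdPair K C)
    (hmax : ∀ K' C', OrdPair K' C' → K ≤ K' → C ⊆ C' → K' ≤ K ∧ C' ⊆ C)
    (y : Ω) (hy : y ∈ K) : y ∈ C ∨ -y ∈ C := by
  have h0 : (0:Ω) ∈ C := by simpa using h.sq 0 (zero_mem _)
  have h1 : (1:Ω) ∈ C := by simpa using h.sq 1 (one_mem _)
  by_cases hn : ∃ c ∈ C, ∃ d ∈ C, (-1 : Ω) = c + y * d
  · obtain ⟨c, hc, d, hd, e⟩ := hn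
    right
    have hd0 : d ≠ 0 := by
      rintro rfl
      apply h.neg; rw [e]; simpa using hc
    have := h.mul _ (h.mul _ (h.add _ h1 _ hc) _ hd) _ (h.sq d⁻¹ (inv_mem (h.sub d hd)))
    convert this using 1
    field_simp
    linear_combination e
  · left
    have hp : OrdPair K {x | ∃ c ∈ C, ∃ d ∈ C, x = c + y * d} := by
      refine ⟨?_, ?_, ?_, ?_, ?_⟩
      · rintro x ⟨c, hc, d, hd, rfl⟩
        exact add_mem (h.sub _ hc) (mul_mem hy (h.sub _ hd))
      · rintro x ⟨c, hc, d, hd, rfl⟩ x' ⟨c', hc', d', hd', rfl⟩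
        exact ⟨c + c', h.add _ hc _ hc', d + d', h.add _ hd _ hd', by ring⟩
      · rintro x ⟨c, hc, d, hd, rfl⟩ x' ⟨c', hc', d', hd', rfl⟩
        exact ⟨c * c' + y * y * (d * d'), h.add _ (h.mul _ hc _ hc') _ (h.mul _ (h.sq _ hy) _
          (h.mul _ hd _ hd')), c * d' + d * c', h.add _ (h.mul _ hc _ hd') _ (h.mul _ hd _ hc'),
          by ring⟩
      · intro x hx
        exact ⟨x * x, h.sq x hx, 0, h0, by ring⟩
      · exact hn
    exact (hmax K _ hp le_rfl (fun c hc => ⟨c, hc, 0, h0, by ring⟩)).2 ⟨0, h0, 1, h1, by ring⟩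

open Classical in
/-- The linear order on `K` given by `C`. -/
@[reducible] noncomputable def pairOrder {K : Subfield Ω} {C : Set Ω} (h : OrdPair K C)
    (ht : ∀ y ∈ K, y ∈ C ∨ -y ∈ C) : LinearOrder K where
  le a b := ((b : Ω) - a) ∈ C
  le_refl a := by simpa using h.sq 0 (zero_mem _)
  le_trans a b c h1 h2 := by
    have := h.add _ h1 _ h2
    simpa using this
  le_antisymm a b h1 h2 := by
    have := h.anti _ h1 (by simpa using h2)
    exact Subtype.ext (sub_eq_zero.1 this).symm
  le_total a b := by
    have := ht ((b : Ω) - a) (sub_mem b.2 a.2)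
    simpa using this
  toDecidableLE := Classical.decRel _

lemma pairOrder_strict {K : Subfield Ω} {C : Set Ω} (h : OrdPair K C)
    (ht : ∀ y ∈ K, y ∈ C ∨ -y ∈ C) :
    letI := pairOrder h ht
    IsStrictOrderedRing K := by
  letI := pairOrder h ht
  have hle : ∀ a b : K, a ≤ b ↔ ((b : Ω) - a) ∈ C := fun a b => Iff.rfl
  have : IsOrderedAddMonoid K := ⟨fun a b hab c => by
    rw [hle] at hab ⊢
    simpa using hab, fun a b hab c => by
    rw [hle] at hab ⊢
    simpa using hab⟩
  have h01 : ZeroLEOneClass K := ⟨by rw [hle]; simpa using h.sq 1 (one_mem _)⟩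
  refine IsStrictOrderedRing.of_mul_pos fun a b ha hb => ?_
  refine lt_of_le_of_ne ?_ (mul_ne_zero ha.ne' hb.ne').symm
  have h1 := ha.le
  have h2 := hb.le
  rw [hle] at h1 h2 ⊢
  simpa using h.mul _ h1 _ h2

lemma max_ivt [IsAlgClosed Ω] {K : Subfield Ω} {C : Set Ω} (h : OrdPair K C)
    (hmax : ∀ K' C', OrdPair K' C' → K ≤ K' → C ⊆ C' → K' ≤ K ∧ C' ⊆ C)
    (ht : ∀ y ∈ K, y ∈ C ∨ -y ∈ C) :
    letI := pairOrder h ht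
    PolyIVT K := by
  letI := pairOrder h ht
  haveI := pairOrder_strict h ht
  have hC0 : ∀ c : K, 0 ≤ c ↔ (c : Ω) ∈ C := fun c => by
    change ((c : Ω) - (0 : K)) ∈ C ↔ _
    simp
  have h1 : (1:Ω) ∈ C := by simpa using h.sq 1 (one_mem _)
  intro p a b hab ha hb
  obtain ⟨q, hq, hqp, hsc⟩ := sc_factor a b p (mul_neg_of_neg_of_pos ha hb)
  obtain ⟨α, hα⟩ := IsAlgClosed.exists_aeval_eq_zero Ω q hq.degree_pos.ne'
  have hαint : IsIntegral K α := (IsAlgebraic.isIntegral ⟨q, hq.ne_zero, hα⟩)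
  set K' : Subfield Ω := (IntermediateField.adjoin K {α}).toSubfield with hK'
  have hmem : ∀ x, x ∈ K' ↔ ∃ g : K[X], aeval α g = x := by
    intro x
    have e : x ∈ K' ↔ x ∈ (IntermediateField.adjoin K {α}).toSubalgebra := Iff.rfl
    rw [e, IntermediateField.adjoin_simple_toSubalgebra_of_isAlgebraic hαint.isAlgebraic,
      Algebra.adjoin_singleton_eq_range_aeval]
    exact Iff.rfl
  set C' : AddSubmonoid Ω := AddSubmonoid.closure
    {x : Ω | ∃ c ∈ C, ∃ g : K[X], x = c * aeval α g ^ 2} with hC'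
  have hKK' : K ≤ K' := fun x hx => (hmem x).2 ⟨Polynomial.C ⟨x, hx⟩, by simp; rfl⟩
  have hpair : OrdPair K' (C' : Set Ω) := by
    refine ⟨?_, fun x hx y hy => add_mem hx hy, ?_, ?_, ?_⟩
    · intro x hx
      induction hx using AddSubmonoid.closure_induction with
      | mem x hx =>
        obtain ⟨c, hc, g, rfl⟩ := hx
        exact mul_mem (hKK' (h.sub c hc)) (pow_mem ((hmem _).2 ⟨g, rfl⟩) 2)
      | zero => exact zero_mem _
      | add x y _ _ h1 h2 => exact add_mem h1 h2
    · intro x hx y hy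
      induction hx using AddSubmonoid.closure_induction with
      | mem x hx =>
        obtain ⟨c, hc, g, rfl⟩ := hx
        induction hy using AddSubmonoid.closure_induction with
        | mem y hy =>
          obtain ⟨c', hc', g', rfl⟩ := hy
          refine AddSubmonoid.subset_closure ⟨c * c', h.mul _ hc _ hc', g * g', ?_⟩
          rw [map_mul]; ring
        | zero => rw [mul_zero]; exact zero_mem _
        | add x y _ _ h1 h2 => rw [mul_add]; exact add_mem h1 h2
      | zero => rw [zero_mul]; exact zero_mem C'
      | add x y _ _ h1 h2 => rw [add_mul]; exact add_mem (S := AddSubmonoid Ω) h1 h2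
    · intro x hx
      obtain ⟨g, rfl⟩ := (hmem x).1 hx
      exact AddSubmonoid.subset_closure ⟨1, h1, g, by ring⟩
    · intro hneg
      have : ∀ x ∈ C', ∃ w ∈ WSos K, x = aeval α w := by
        intro x hx
        induction hx using AddSubmonoid.closure_induction with
        | mem x hx =>
          obtain ⟨c, hc, g, rfl⟩ := hx
          refine ⟨Polynomial.C ⟨c, h.sub c hc⟩ * g ^ 2,
            AddSubmonoid.subset_closure ⟨⟨c, h.sub c hc⟩, g, (hC0 _).2 hc, rfl⟩, ?_⟩
          simp; left; rfl
        | zero => exact ⟨0, zero_mem _, by simp⟩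
        | add x y _ _ h1 h2 =>
          obtain ⟨w, hw, rfl⟩ := h1
          obtain ⟨w', hw', rfl⟩ := h2
          exact ⟨w + w', add_mem hw hw', by simp⟩
      obtain ⟨w, hw, e⟩ := this _ hneg
      refine no_dvd a b _ q rfl hq hsc w hw ?_
      have hz : aeval α (1 + w) = 0 := by rw [map_add, ← e]; simp
      have hd := minpoly.dvd K α hz
      have hqm : q ∣ minpoly K α := by
        have hassoc : Associated (minpoly K α) q :=
          (minpoly.irreducible hαint).associated_of_dvd hq (minpoly.dvd K α hα)
        exact hassoc.symm.dvd
      exact hqm.trans hd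
  have hαK : α ∈ K := (hmax K' C' hpair hKK' (fun c hc =>
    AddSubmonoid.subset_closure ⟨c, hc, 1, by simp⟩)).1 ((hmem α).2 ⟨X, by simp⟩)
  set c : K := ⟨α, hαK⟩ with hc
  have hqc : q.eval c = 0 := by
    have : aeval α q = ((q.eval c : K) : Ω) := by
      have h2 := aeval_algebraMap_apply Ω c q
      rw [show algebraMap K Ω c = α from rfl] at h2
      rw [h2]; simp; rfl
    rw [this] at hα
    exact Subtype.ext hα
  obtain ⟨s, hs⟩ := dvd_iff_isRoot.2 (show IsRoot q c from hqc)
  have hdeg := degree_eq_one_of_irreducible_of_root hq (show IsRoot q c from hqc)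
  have hsd : s.natDegree = 0 := by
    have hs0 : s ≠ 0 := by rintro rfl; simp at hs; exact hq.ne_zero hs
    have e1 : q.natDegree = 1 := natDegree_eq_of_degree_eq_some (by simpa using hdeg)
    rw [hs, natDegree_mul (X_sub_C_ne_zero c) hs0, natDegree_X_sub_C] at e1
    omega
  obtain ⟨u, hu⟩ := natDegree_eq_zero.1 hsd
  have hsc' : ((a - c) * (b - c)) * (u * u) < 0 := by
    have : q.eval a * q.eval b = ((a - c) * (b - c)) * (u * u) := by
      rw [hs, ← hu]; simp; ring
    rwa [← this]
  have hsc2 : (a - c) * (b - c) < 0 := by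
    by_contra hcon
    have := mul_nonneg (not_lt.1 hcon) (mul_self_nonneg u)
    exact absurd hsc' (not_lt.2 this)
  refine ⟨c, ?_, ?_, ?_⟩
  · by_contra hcon
    have hca := not_lt.1 hcon
    have := mul_nonneg (sub_nonneg.2 hca) (sub_nonneg.2 (hca.trans hab.le))
    exact absurd hsc2 (not_lt.2 this)
  · by_contra hcon
    have hca := not_lt.1 hcon
    have := mul_nonneg_of_nonpos_of_nonpos (sub_nonpos.2 (hab.le.trans hca)) (sub_nonpos.2 hca)
    exact absurd hsc2 (not_lt.2 this)
  · obtain ⟨r, hr⟩ := hqp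
    rw [hr, eval_mul, hqc, zero_mul]
end rcf
end part5

section part6
open Polynomial

lemma ordpair_of_hom {A Ω : Type*} [CommRing A] [Field Ω] (S : Set A)
    (hadd : ∀ x ∈ S, ∀ y ∈ S, x + y ∈ S) (hmul : ∀ x ∈ S, ∀ y ∈ S, x * y ∈ S)
    (hsq : ∀ x, x * x ∈ S)
    (p : Ideal A) (hp : p.IsPrime) (hpS : ∀ x, x ∈ p ↔ x ∈ S ∧ -x ∈ S) (ψ : A →+* Ω)
    (hψ : ∀ a, ψ a = 0 ↔ a ∈ p) (K₀ : Subfield Ω)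
    (hK₀ : ∀ x ∈ K₀, ∃ a b, ψ b ≠ 0 ∧ x = ψ a / ψ b) (hψK : ∀ a, ψ a ∈ K₀) :
    OrdPair K₀ {x | ∃ s ∈ S, ∃ b, ψ b ≠ 0 ∧ x = ψ s / (ψ b) ^ 2} := by
  refine ⟨?_, ?_, ?_, ?_, ?_⟩
  · rintro _ ⟨s, hs, b, hb, rfl⟩
    exact div_mem (hψK _) (pow_mem (hψK _) 2)
  · rintro _ ⟨s, hs, b, hb, rfl⟩ _ ⟨s', hs', b', hb', rfl⟩
    refine ⟨s * (b' * b') + s' * (b * b), hadd _ (hmul _ hs _ (hsq _)) _ (hmul _ hs' _ (hsq _)),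
      b * b', by rw [map_mul]; exact mul_ne_zero hb hb', ?_⟩
    simp only [map_add, map_mul]
    field_simp
  · rintro _ ⟨s, hs, b, hb, rfl⟩ _ ⟨s', hs', b', hb', rfl⟩
    refine ⟨s * s', hmul _ hs _ hs',
      b * b', by rw [map_mul]; exact mul_ne_zero hb hb', ?_⟩
    simp only [map_mul]
    field_simp
  · intro x hx
    obtain ⟨a, b, hb, rfl⟩ := hK₀ x hx
    refine ⟨a * a, hsq a, b, hb, ?_⟩
    simp only [map_mul]
    field_simp
  · rintro ⟨s, hs, b, hb, e⟩
    have e2 : ψ (s + b * b) = 0 := by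
      simp only [map_add, map_mul]
      field_simp at e
      linear_combination -e
    rw [hψ, hpS] at e2
    have h3 : -(b * b) ∈ S := by
      have := hadd _ e2.2 _ hs
      convert this using 1; ring
    have h4 : b * b ∈ p := (hpS _).2 ⟨hsq b, h3⟩
    rcases hp.mem_or_mem h4 with h | h <;> exact hb ((hψ b).2 h)

lemma ordered_field_of_cone {A : Type} [CommRing A] [Countable A] (S : Set A)
    (hadd : ∀ x ∈ S, ∀ y ∈ S, x + y ∈ S) (hmul : ∀ x ∈ S, ∀ y ∈ S, x * y ∈ S)
    (hsq : ∀ x, x * x ∈ S) (hneg : (-1 : A) ∉ S)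
    (p : Ideal A) (hp : p.IsPrime) (hpS : ∀ x, x ∈ p ↔ x ∈ S ∧ -x ∈ S) :
    ∃ (F : Type) (_ : Field F) (_ : LinearOrder F) (_ : IsStrictOrderedRing F) (_ : Countable F)
      (_ : PolyIVT F) (φ : A →+* F), ∀ a ∈ S, 0 ≤ φ a := by
  let Q := FractionRing (A ⧸ p)
  let Ω := AlgebraicClosure Q
  have cA : Countable (A ⧸ p) := Quotient.countable
  have cQ : Countable Q := by
    have : Function.Surjective (fun x : (A ⧸ p) × (A ⧸ p) => algebraMap (A ⧸ p) Q x.1 / algebraMap (A ⧸ p) Q x.2) := by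
      intro z
      obtain ⟨x, y, _, h⟩ := IsFractionRing.div_surjective (A := A ⧸ p) z
      exact ⟨(x, y), h⟩
    exact this.countable
  have cΩ : Countable Ω := by
    rw [← Cardinal.mk_le_aleph0_iff] at cQ ⊢
    exact (Algebra.IsAlgebraic.cardinalMk_le_max Q Ω).trans (max_le cQ le_rfl)
  let ψ : A →+* Ω := (algebraMap Q Ω).comp ((algebraMap (A ⧸ p) Q).comp (Ideal.Quotient.mk p))
  have hψ : ∀ a, ψ a = 0 ↔ a ∈ p := by
    intro a
    change algebraMap Q Ω (algebraMap (A ⧸ p) Q (Ideal.Quotient.mk p a)) = 0 ↔ _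
    rw [map_eq_zero_iff _ (algebraMap Q Ω).injective,
      map_eq_zero_iff _ (IsFractionRing.injective (A ⧸ p) Q), Ideal.Quotient.eq_zero_iff_mem]
  let K₀ : Subfield Ω := (algebraMap Q Ω).fieldRange
  have hK₀ : ∀ x ∈ K₀, ∃ a b, ψ b ≠ 0 ∧ x = ψ a / ψ b := by
    rintro _ ⟨z, rfl⟩
    obtain ⟨x, y, hy, h⟩ := IsFractionRing.div_surjective (A := A ⧸ p) z
    obtain ⟨a, rfl⟩ := Ideal.Quotient.mk_surjective x
    obtain ⟨b, rfl⟩ := Ideal.Quotient.mk_surjective y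
    refine ⟨a, b, ?_, ?_⟩
    · rw [Ne, hψ, ← Ideal.Quotient.eq_zero_iff_mem]
      exact nonZeroDivisors.ne_zero hy
    · rw [← h, map_div₀]; rfl
  have hψK : ∀ a, ψ a ∈ K₀ := fun a => ⟨_, rfl⟩
  let C₀ : Set Ω := {x | ∃ s ∈ S, ∃ b, ψ b ≠ 0 ∧ x = ψ s / (ψ b) ^ 2}
  have h1S : (1 : A) ∈ S := by simpa using hsq 1
  have h₀ : OrdPair K₀ C₀ := ordpair_of_hom S hadd hmul hsq p hp hpS ψ hψ K₀ hK₀ hψK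
  obtain ⟨K, C, hKC, hK, hC, hmax⟩ := exists_max_pair K₀ C₀ h₀
  have ht := max_total hKC hmax
  refine ⟨K, inferInstance, pairOrder hKC ht, pairOrder_strict hKC ht, inferInstance,
    max_ivt hKC hmax ht, ψ.codRestrict K (fun a => hK (hψK a)), ?_⟩
  intro a ha
  change (((ψ.codRestrict K (fun a => hK (hψK a)) a : K) : Ω) - (0 : K)) ∈ C
  apply hC
  exact ⟨a, ha, 1, by simp, by simp⟩

/-- preordering in a ring -/
structure IsPre {A : Type*} [CommRing A] (S : Set A) : Prop where
  add : ∀ x ∈ S, ∀ y ∈ S, x + y ∈ S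
  mul : ∀ x ∈ S, ∀ y ∈ S, x * y ∈ S
  sq : ∀ x, x * x ∈ S

lemma IsPre.zero {A : Type*} [CommRing A] {S : Set A} (h : IsPre S) : (0:A) ∈ S := by
  simpa using h.sq 0
lemma IsPre.one {A : Type*} [CommRing A] {S : Set A} (h : IsPre S) : (1:A) ∈ S := by
  simpa using h.sq 1

lemma IsPre.adjoin {A : Type*} [CommRing A] {S : Set A} (h : IsPre S) (y : A) :
    IsPre {x | ∃ c ∈ S, ∃ d ∈ S, x = c + y * d} := by
  refine ⟨?_, ?_, ?_⟩
  · rintro x ⟨c, hc, d, hd, rfl⟩ x' ⟨c', hc', d', hd', rfl⟩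
    exact ⟨c + c', h.add _ hc _ hc', d + d', h.add _ hd _ hd', by ring⟩
  · rintro x ⟨c, hc, d, hd, rfl⟩ x' ⟨c', hc', d', hd', rfl⟩
    exact ⟨c * c' + y * y * (d * d'), h.add _ (h.mul _ hc _ hc') _ (h.mul _ (h.sq _) _
          (h.mul _ hd _ hd')), c * d' + d * c', h.add _ (h.mul _ hc _ hd') _ (h.mul _ hd _ hc'),
          by ring⟩
  · intro x
    exact ⟨x * x, h.sq x, 0, h.zero, by ring⟩

lemma exists_max_pre {A : Type*} [CommRing A] (T : Set A) (hT : IsPre T) (hneg : (-1:A) ∉ T) :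
    ∃ S, T ⊆ S ∧ IsPre S ∧ (-1:A) ∉ S ∧ (∀ x, x ∈ S ∨ -x ∈ S) ∧
      ∀ x y, x * y ∈ S → -(x * y) ∈ S → (x ∈ S ∧ -x ∈ S) ∨ (y ∈ S ∧ -y ∈ S) := by
  obtain ⟨S, hle, hmx⟩ := zorn_subset_nonempty {S : Set A | IsPre S ∧ (-1:A) ∉ S} (by
    intro c hc hch ⟨y, hy⟩
    have key : ∀ a ∈ ⋃₀ c, ∀ b ∈ ⋃₀ c, ∃ P ∈ c, a ∈ P ∧ b ∈ P := by
      rintro a ⟨P, hP, ha⟩ b ⟨Q, hQ, hb⟩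
      rcases hch.total hP hQ with h | h
      · exact ⟨Q, hQ, h ha, hb⟩
      · exact ⟨P, hP, ha, h hb⟩
    refine ⟨⋃₀ c, ⟨⟨?_, ?_, ?_⟩, ?_⟩, fun s hs => Set.subset_sUnion_of_mem hs⟩
    · intro a ha b hb
      obtain ⟨P, hP, h1, h2⟩ := key a ha b hb
      exact ⟨P, hP, (hc hP).1.add _ h1 _ h2⟩
    · intro a ha b hb
      obtain ⟨P, hP, h1, h2⟩ := key a ha b hb
      exact ⟨P, hP, (hc hP).1.mul _ h1 _ h2⟩
    · intro a
      exact ⟨y, hy, (hc hy).1.sq a⟩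
    · rintro ⟨P, hP, h⟩
      exact (hc hP).2 h) T ⟨hT, hneg⟩
  obtain ⟨h, hn⟩ := hmx.prop
  have ext : ∀ y, y ∉ S → ∃ c ∈ S, ∃ d ∈ S, -1 = c + y * d := by
    intro y hy
    by_contra hcon
    have hsub : S ⊆ {x | ∃ c ∈ S, ∃ d ∈ S, x = c + y * d} :=
      fun c hc => ⟨c, hc, 0, h.zero, by ring⟩
    exact hy (hmx.le_of_ge (y := {x | ∃ c ∈ S, ∃ d ∈ S, x = c + y * d}) ⟨h.adjoin y, hcon⟩ hsub
      ⟨0, h.zero, 1, h.one, by ring⟩)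
  have tot : ∀ x, x ∈ S ∨ -x ∈ S := by
    intro x
    by_contra hcon
    push Not at hcon
    obtain ⟨a, ha, b, hb, e⟩ := ext _ hcon.1
    obtain ⟨c, hc, d, hd, e'⟩ := ext _ hcon.2
    apply hn
    have : a + c + a * c + x * x * (b * d) ∈ S :=
      h.add _ (h.add _ (h.add _ ha _ hc) _ (h.mul _ ha _ hc)) _ (h.mul _ (h.sq x) _ (h.mul _ hb _ hd))
    convert this using 1
    linear_combination (1 + c) * e - x * b * e'
  refine ⟨S, hle, h, hn, tot, ?_⟩
  -- primeness
  have key : ∀ x y, x ∈ S → y ∈ S → -(x * y) ∈ S → -x ∈ S ∨ -y ∈ S := by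
    intro x y hx hy hxy
    by_contra hcon
    push Not at hcon
    obtain ⟨a, ha, b, hb, e⟩ := ext _ hcon.1
    obtain ⟨c, hc, d, hd, e'⟩ := ext _ hcon.2
    apply hn
    have : a + c + a * c + (-(x * y)) * (b * d) ∈ S :=
      h.add _ (h.add _ (h.add _ ha _ hc) _ (h.mul _ ha _ hc)) _ (h.mul _ hxy _ (h.mul _ hb _ hd))
    convert this using 1
    linear_combination (1 + c) * e + x * b * e'
  intro x y h1 h2
  rcases tot x with hx | hx <;> rcases tot y with hy | hy
  · rcases key x y hx hy h2 with k | k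
    · exact Or.inl ⟨hx, k⟩
    · exact Or.inr ⟨hy, k⟩
  · rcases key x (-y) hx hy (by simpa using h1) with k | k
    · exact Or.inl ⟨hx, k⟩
    · exact Or.inr ⟨by simpa using k, hy⟩
  · rcases key (-x) y hx hy (by simpa using h1) with k | k
    · exact Or.inl ⟨by simpa using k, hx⟩
    · exact Or.inr ⟨hy, k⟩
  · rcases key (-x) (-y) hx hy (by simpa using h2) with k | k
    · exact Or.inl ⟨by simpa using k, hx⟩
    · exact Or.inr ⟨by simpa using k, hy⟩

/-- support ideal -/
def suppIdeal {A : Type*} [CommRing A] (S : Set A) (h : IsPre S)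
    (tot : ∀ x, x ∈ S ∨ -x ∈ S) : Ideal A where
  carrier := {x | x ∈ S ∧ -x ∈ S}
  zero_mem' := by simpa using h.zero
  add_mem' := by
    rintro a b ⟨h1, h2⟩ ⟨h3, h4⟩
    refine ⟨h.add _ h1 _ h3, ?_⟩
    rw [neg_add]; exact h.add _ h2 _ h4
  smul_mem' := by
    rintro c x ⟨h1, h2⟩
    simp only [smul_eq_mul, Set.mem_ofPred_eq]
    rcases tot c with hc | hc
    · exact ⟨h.mul _ hc _ h1, by rw [← mul_neg]; exact h.mul _ hc _ h2⟩
    · exact ⟨by rw [← neg_mul_neg]; exact h.mul _ hc _ h2, by rw [← neg_mul]; exact h.mul _ hc _ h1⟩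

lemma suppIdeal_prime {A : Type*} [CommRing A] (S : Set A) (h : IsPre S)
    (tot : ∀ x, x ∈ S ∨ -x ∈ S) (hn : (-1:A) ∉ S)
    (hpr : ∀ x y, x * y ∈ S → -(x * y) ∈ S → (x ∈ S ∧ -x ∈ S) ∨ (y ∈ S ∧ -y ∈ S)) :
    (suppIdeal S h tot).IsPrime := by
  refine ⟨?_, ?_⟩
  · rw [Ideal.ne_top_iff_one]
    exact fun h1 => hn h1.2
  · intro x y hxy
    exact hpr x y hxy.1 hxy.2
end part6

section part7
open MvPolynomial Filter

lemma transfer {σ : Type} [Countable σ] {κ : Type*} [Finite κ] (T : Set (MvPolynomial σ ℝ))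
    (hT : IsPre T) (hneg : (-1 : MvPolynomial σ ℝ) ∉ T) (u : κ → MvPolynomial σ ℝ)
    (hu : ∀ i, u i ∈ T) : ∃ x : σ → ℝ, ∀ i, 0 ≤ eval x (u i) := by
  obtain ⟨S, hTS, hS, hn, tot, hpr⟩ := exists_max_pre T hT hneg
  set k : Subfield ℝ := Subfield.closure (⋃ i, ((u i).coeffs : Set ℝ)) with hk
  have ck : Countable k := by
    have h1 : (⋃ i, ((u i).coeffs : Set ℝ)).Countable :=
      Set.countable_iUnion fun i => (Finset.countable_toSet _)
    rw [← Cardinal.mk_le_aleph0_iff]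
    exact (Subfield.cardinalMk_closure_le_max _).trans (max_le (Set.countable_coe_iff.2 h1 |> Cardinal.mk_le_aleph0_iff.2) le_rfl)
  have cA : Countable (MvPolynomial σ k) := by
    rw [← Cardinal.mk_le_aleph0_iff]
    refine MvPolynomial.cardinalMk_le_max.trans ?_
    simp [Cardinal.mk_le_aleph0_iff, ck]
  let μ : MvPolynomial σ k →+* MvPolynomial σ ℝ := MvPolynomial.map k.subtype
  have hlift : ∀ i, ∃ w, μ w = u i := by
    intro i
    have : u i ∈ Set.range (MvPolynomial.map k.subtype : MvPolynomial σ k → MvPolynomial σ ℝ) := by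
      rw [MvPolynomial.mem_range_map_iff_coeffs_subset]
      intro c hc
      exact ⟨⟨c, Subfield.subset_closure (Set.mem_iUnion.2 ⟨i, hc⟩)⟩, rfl⟩
    exact this
  choose w hw using hlift
  let S0 : Set (MvPolynomial σ k) := μ ⁻¹' S
  have hS0 : IsPre S0 := by
    refine ⟨fun x hx y hy => ?_, fun x hx y hy => ?_, fun x => ?_⟩
    · change μ _ ∈ S; rw [map_add]; exact hS.add _ hx _ hy
    · change μ _ ∈ S; rw [map_mul]; exact hS.mul _ hx _ hy
    · change μ _ ∈ S; rw [map_mul]; exact hS.sq _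
  have htot0 : ∀ x, x ∈ S0 ∨ -x ∈ S0 := by
    intro x
    have := tot (μ x)
    rw [← map_neg] at this
    exact this
  have hn0 : (-1 : MvPolynomial σ k) ∉ S0 := by
    intro h
    apply hn
    have : μ (-1) ∈ S := h
    simpa using this
  have hpr0 : ∀ x y, x * y ∈ S0 → -(x * y) ∈ S0 → (x ∈ S0 ∧ -x ∈ S0) ∨ (y ∈ S0 ∧ -y ∈ S0) := by
    intro x y h1 h2
    have h1' : μ (x * y) ∈ S := h1
    have h2' : μ (-(x * y)) ∈ S := h2
    have := hpr (μ x) (μ y) (by simpa using h1') (by simpa using h2')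
    rw [← map_neg, ← map_neg] at this
    exact this
  obtain ⟨F, iF, oF, sF, cF, hF, φ, hφ⟩ := ordered_field_of_cone S0 hS0.add hS0.mul hS0.sq hn0
    (suppIdeal S0 hS0 htot0) (suppIdeal_prime S0 hS0 htot0 hn0 hpr0) (fun x => Iff.rfl)
  let ι : k →+* F × HR := (φ.comp C).prod (HRc.comp k.subtype)
  have hpos : ∀ c : k, 0 < (c : ℝ) → 0 < φ (C c) := by
    intro c hc
    refine lt_of_le_of_ne (hφ _ ?_) ?_
    · change μ (C c) ∈ S
      have : μ (C c) = C (Real.sqrt c) * C (Real.sqrt c) := by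
        rw [← C_mul, Real.mul_self_sqrt hc.le]
        simp [μ]
      rw [this]; exact hS.sq _
    · intro h0
      have : c = 0 := (φ.comp C).injective (by simpa using h0.symm)
      simp [this] at hc
  have hΓ₀ : GoodSub ι.range := by
    rintro _ ⟨c, rfl⟩
    change SignType.sign (φ (C c)) = SignType.sign (HRc c)
    rw [HRc_sign]
    rcases lt_trichotomy (c : ℝ) 0 with h | h | h
    · rw [sign_neg h, sign_neg]
      have := hpos (-c) (by simpa using h)
      simpa using this
    · have : c = 0 := Subtype.ext h
      simp [this]
    · rw [sign_pos h, sign_pos (hpos c h)]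
  obtain ⟨Γ, hΓ₁, hΓ, hall⟩ := embed_exists hF HR_ivt HR_sat ι.range hΓ₀
  choose β hβ using fun v => hall (φ (X v))
  choose y hy using fun v => HR_exists_rep (β v)
  let Θ : MvPolynomial σ k →+* F × HR := eval₂Hom ι (fun v => (φ (X v), β v))
  have hΘΓ : ∀ q, Θ q ∈ Γ := by
    intro q
    induction q using MvPolynomial.induction_on with
    | C a => simpa [Θ] using hΓ₁ ⟨a, rfl⟩
    | add p q hp hq => rw [map_add]; exact add_mem hp hq
    | mul_X p v hp =>
      rw [map_mul]
      exact mul_mem hp (by simpa [Θ] using hβ v)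
  have hΘ1 : ∀ q, (Θ q).1 = φ q := by
    intro q
    have : (RingHom.fst F HR).comp Θ = φ := by
      apply MvPolynomial.ringHom_ext
      · intro r; simp [Θ, ι]
      · intro r; simp [Θ]
    exact congrArg (fun f : MvPolynomial σ k →+* F => f q) this
  have hΘ2 : ∀ q, (Θ q).2 = eval₂ HRc (fun v => (y v : HR)) (μ q) := by
    intro q
    have : (RingHom.snd F HR).comp Θ = (eval₂Hom HRc (fun v => (y v : HR))).comp μ := by
      apply MvPolynomial.ringHom_ext
      · intro r; simp [Θ, ι, μ]
      · intro r; simp [Θ, μ, hy]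
    exact congrArg (fun f : MvPolynomial σ k →+* HR => f q) this
  have hev : ∀ i, ∀ᶠ n in (hyperfilter ℕ : Filter ℕ), 0 ≤ eval (fun v => y v n) (u i) := by
    intro i
    have h1 : 0 ≤ (Θ (w i)).1 := by
      rw [hΘ1]; apply hφ; change μ (w i) ∈ S; rw [hw]; exact hTS (hu i)
    have h2 : 0 ≤ (Θ (w i)).2 := by
      have hs := hΓ _ (hΘΓ (w i))
      rw [← sign_nonneg_iff] at h1 ⊢
      rwa [← hs]
    rw [hΘ2, hw, HR_mveval] at h2
    exact Germ.coe_le.1 h2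
  obtain ⟨n, hn⟩ := (eventually_all.2 hev).exists
  exact ⟨fun v => y v n, hn⟩
end part7

section part8
open MvPolynomial

lemma psatz {σ : Type} [Countable σ] {κ : Type*} [Finite κ] (T : Set (MvPolynomial σ ℝ))
    (hT : IsPre T) (h : κ → MvPolynomial σ ℝ) (hh : ∀ i, h i ∈ T) (f : MvPolynomial σ ℝ)
    (hf : ∀ x, (∀ i, 0 ≤ eval x (h i)) → 0 < eval x f) :
    ∃ s ∈ T, ∃ t ∈ T, s * f = 1 + t := by
  by_contra hcon
  have hn : (-1 : MvPolynomial σ ℝ) ∉ {x | ∃ c ∈ T, ∃ d ∈ T, x = c + (-f) * d} := by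
    rintro ⟨c, hc, d, hd, e⟩
    exact hcon ⟨d, hd, c, hc, by linear_combination e⟩
  obtain ⟨x, hx⟩ := transfer _ (hT.adjoin (-f)) hn (fun i : Option κ => i.elim (-f) h) (by
    rintro (_ | i)
    · exact ⟨0, hT.zero, 1, hT.one, by simp⟩
    · exact ⟨h i, hh i, 0, hT.zero, by simp⟩)
  have h1 := hf x (fun i => hx (some i))
  have h2 := hx none
  simp at h2
  linarith

section arch
variable {σ : Type} {T : Set (MvPolynomial σ ℝ)}

lemma IsPre.const (hT : IsPre T) (r : ℝ) (hr : 0 ≤ r) : (C r : MvPolynomial σ ℝ) ∈ T := by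
  have := hT.sq (C (Real.sqrt r))
  rwa [← C_mul, Real.mul_self_sqrt hr] at this

/-- archimedean preordering -/
def IsArch (T : Set (MvPolynomial σ ℝ)) : Prop := ∀ p, ∃ N : ℝ, C N - p ∈ T

lemma IsArch.bound (hT : IsPre T) (hA : IsArch T) (p : MvPolynomial σ ℝ) :
    ∃ N : ℝ, 1 ≤ N ∧ C N - p ∈ T := by
  obtain ⟨N, hN⟩ := hA p
  refine ⟨max N 1, le_max_right _ _, ?_⟩
  have := hT.add _ hN _ (hT.const (max N 1 - N) (sub_nonneg.2 (le_max_left _ _)))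
  convert this using 1
  rw [C_sub]; ring

lemma pos_mem [Countable σ] {κ : Type*} [Finite κ] (hT : IsPre T) (hA : IsArch T)
    (h : κ → MvPolynomial σ ℝ) (hh : ∀ i, h i ∈ T) (f : MvPolynomial σ ℝ)
    (hf : ∀ x, (∀ i, 0 ≤ eval x (h i)) → 0 < eval x f) : f ∈ T := by
  obtain ⟨s, hs, t, ht, e⟩ := psatz T hT h hh f hf
  obtain ⟨N, hN1, hN⟩ := hA.bound hT s
  obtain ⟨r₀, hr1, hr₀⟩ := hA.bound hT (-f)
  have step : ∀ r : ℝ, 0 ≤ r → f + C r ∈ T → f + C (r - 1 / N) ∈ T := by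
    intro r hr hfr
    have h1 := hT.add _ (hT.add _ (hT.mul _ hN _ hfr) _ ht) _ (hT.mul _ (hT.const r hr) _ hs)
    have h2 := hT.mul _ (hT.const (1 / N) (by positivity)) _ h1
    convert h2 using 1
    have hc : (C (1 / N) * C N : MvPolynomial σ ℝ) = 1 := by
      rw [← C_mul, one_div_mul_cancel (by positivity), C_1]
    rw [C_sub]
    linear_combination (-f - C r) * hc + C (1 / N) * e
  have main : ∀ n : ℕ, ∀ r : ℝ, 0 ≤ r → r ≤ n * (1 / N) → f + C r ∈ T → f ∈ T := by
    intro n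
    induction n with
    | zero =>
      intro r h0 h1 h2
      have : r = 0 := le_antisymm (by simpa using h1) h0
      simpa [this] using h2
    | succ n ih =>
      intro r h0 h1 h2
      have h3 := step r h0 h2
      rcases le_total 0 (r - 1 / N) with h | h
      · refine ih _ h ?_ h3
        push_cast at h1
        linarith
      · have := hT.add _ h3 _ (hT.const (1 / N - r) (by linarith))
        convert this using 1
        rw [C_sub, C_sub]; ring
  obtain ⟨n, hn⟩ := exists_nat_ge (r₀ * N)
  refine main n r₀ (by linarith) ?_ ?_
  · rw [mul_one_div, le_div_iff₀ (by linarith)]; exact hn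
  · convert hr₀ using 1; ring

lemma arch_of_ball [Fintype σ] (hT : IsPre T) (N : ℝ) (hN : C N - ∑ v, X v ^ 2 ∈ T) :
    IsArch T := by
  have half : ∀ p, p + p ∈ T → p ∈ T := by
    intro p hp
    have := hT.mul _ (hT.const (1 / 2) (by norm_num)) _ hp
    convert this using 1
    have : (C (1 / 2) + C (1/2) : MvPolynomial σ ℝ) = 1 := by rw [← C_add]; norm_num
    linear_combination (-p) * this
  have key : ∀ p : MvPolynomial σ ℝ, ∃ M : ℝ, C M - p ∈ T ∧ C M + p ∈ T := by
    intro p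
    induction p using MvPolynomial.induction_on with
    | C a =>
      refine ⟨|a|, ?_, ?_⟩
      · rw [← C_sub]; exact hT.const _ (sub_nonneg.2 (le_abs_self a))
      · rw [← C_add]; exact hT.const _ (by linarith [neg_abs_le a])
    | add p q hp hq =>
      obtain ⟨M, h1, h2⟩ := hp
      obtain ⟨M', h3, h4⟩ := hq
      refine ⟨M + M', ?_, ?_⟩
      · have := hT.add _ h1 _ h3
        convert this using 1; rw [C_add]; ring
      · have := hT.add _ h2 _ h4
        convert this using 1; rw [C_add]; ring
    | mul_X p v hp =>
      obtain ⟨M, h1, h2⟩ := hp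
      classical
      have hv : C N - X v ^ 2 ∈ T := by
        have hs : ∀ s : Finset σ, ∑ w ∈ s, (X w : MvPolynomial σ ℝ) ^ 2 ∈ T := by
          intro s
          induction s using Finset.induction_on with
          | empty => simpa using hT.zero
          | insert a s ha ih =>
            rw [Finset.sum_insert ha, sq]
            exact hT.add _ (hT.sq _) _ ih
        have := hT.add _ hN _ (hs (Finset.univ.erase v))
        rw [← Finset.add_sum_erase _ _ (Finset.mem_univ v)] at this
        convert this using 1; ring
      have hc : (C (1 / 4) : MvPolynomial σ ℝ) = C (1/2) * C (1/2) := by rw [← C_mul]; norm_num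
      have hc2 : (C (1 / 2) + C (1/2) : MvPolynomial σ ℝ) = 1 := by rw [← C_add]; norm_num
      have h3 : C (N + 1 / 4) - X v ∈ T := by
        have := hT.add _ hv _ (hT.sq (X v - C (1 / 2)))
        convert this using 1
        rw [C_add, hc]; linear_combination X v * hc2
      have h4 : C (N + 1 / 4) + X v ∈ T := by
        have := hT.add _ hv _ (hT.sq (X v + C (1 / 2)))
        convert this using 1
        rw [C_add, hc]; linear_combination -X v * hc2
      refine ⟨M * (N + 1 / 4), half _ ?_, half _ ?_⟩
      · have := hT.add _ (hT.mul _ h1 _ h4) _ (hT.mul _ h2 _ h3)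
        convert this using 1
        rw [C_mul]; ring
      · have := hT.add _ (hT.mul _ h1 _ h3) _ (hT.mul _ h2 _ h4)
        convert this using 1
        rw [C_mul]; ring
  intro p
  obtain ⟨M, h, _⟩ := key p
  exact ⟨M, h⟩

lemma arch_of_compact [Fintype σ] {κ : Type*} [Finite κ] (hT : IsPre T)
    (h : κ → MvPolynomial σ ℝ) (hh : ∀ i, h i ∈ T) (N : ℝ) (hN0 : 0 ≤ N)
    (hN : ∀ x : σ → ℝ, (∀ i, 0 ≤ eval x (h i)) → ∑ v, x v ^ 2 < N) : IsArch T := by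
  set q : MvPolynomial σ ℝ := C N - ∑ v, X v ^ 2 with hq
  obtain ⟨s, hs, t, ht, e⟩ := psatz T hT h hh q (by
    intro x hx
    have := hN x hx
    simp [hq]
    exact this)
  have hA' : IsArch {x | ∃ c ∈ T, ∃ d ∈ T, x = c + q * d} :=
    arch_of_ball (hT.adjoin q) N ⟨0, hT.zero, 1, hT.one, by simp [hq]⟩
  obtain ⟨c, hc1, p0, hp0, p1, hp1, e1⟩ := hA'.bound (hT.adjoin q) t
  have hqq : (1 + t) * q ∈ T := by
    have := hT.mul _ hs _ (hT.sq q)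
    convert this using 1
    linear_combination -q * e
  have h1t : 1 + t ∈ T := hT.add _ hT.one _ ht
  have h2 : (1 + t) * (C c - t) ∈ T := by
    have := hT.add _ (hT.mul _ h1t _ hp0) _ (hT.mul _ hqq _ hp1)
    rw [e1]
    convert this using 1
    ring
  have h3 : C (c + ((c - 1) / 2) ^ 2 + 1 / 4 + (c - 1) / 2) - t ∈ T := by
    have := hT.add _ h2 _ (hT.sq (t - C ((c - 1) / 2) - C (1 / 2)))
    convert this using 1
    have hc2 : (C (1 / 2) + C (1/2) : MvPolynomial σ ℝ) = 1 := by rw [← C_add]; norm_num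
    have hc : (C (1 / 4) : MvPolynomial σ ℝ) = C (1/2) * C (1/2) := by rw [← C_mul]; norm_num
    have hc3 : (C c : MvPolynomial σ ℝ) = C ((c - 1) / 2) + C ((c - 1) / 2) + 1 := by
      rw [← C_add, ← C_1, ← C_add]; congr 1; ring
    simp only [C_add, C_pow]
    rw [hc, hc3]
    linear_combination (t - C ((c - 1) / 2)) * hc2
  set c' := c + ((c - 1) / 2) ^ 2 + 1 / 4 + (c - 1) / 2 with hc'
  have hsum : ∑ v, (X v : MvPolynomial σ ℝ) ^ 2 ∈ T := by
    classical
    have hs : ∀ s : Finset σ, ∑ w ∈ s, (X w : MvPolynomial σ ℝ) ^ 2 ∈ T := by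
      intro s
      induction s using Finset.induction_on with
      | empty => simpa using hT.zero
      | insert a s ha ih =>
        rw [Finset.sum_insert ha, sq]
        exact hT.add _ (hT.sq _) _ ih
    exact hs _
  refine arch_of_ball hT (N * (1 + c')) ?_
  have := hT.add _ (hT.add _ hqq _ (hT.mul _ ht _ hsum)) _ (hT.mul _ (hT.const N hN0) _ h3)
  convert this using 1
  rw [hq, C_mul, C_add, C_1]
  ring
end arch
end part8

section part9
open MvPolynomial

lemma isSOS_iff {ι : Type*} (q : MvPolynomial ι ℝ) : IsSOS q ↔ IsSumSq q := by
  constructor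
  · rintro ⟨k, s, rfl⟩
    exact IsSumSq.sum fun i _ => by rw [sq]; exact IsSumSq.mul_self _
  · intro h
    induction h with
    | zero => exact ⟨0, Fin.elim0, by simp⟩
    | sq_add a h ih =>
      obtain ⟨k, s, rfl⟩ := ih
      exact ⟨k + 1, Fin.cons a s, by rw [Fin.sum_univ_succ]; simp [sq]⟩

lemma IsSOS.zero {ι : Type*} : IsSOS (0 : MvPolynomial ι ℝ) := (isSOS_iff _).2 IsSumSq.zero
lemma IsSOS.add {ι : Type*} {p q : MvPolynomial ι ℝ} (hp : IsSOS p) (hq : IsSOS q) :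
    IsSOS (p + q) := (isSOS_iff _).2 (((isSOS_iff _).1 hp).add ((isSOS_iff _).1 hq))
lemma IsSOS.mul {ι : Type*} {p q : MvPolynomial ι ℝ} (hp : IsSOS p) (hq : IsSOS q) :
    IsSOS (p * q) := (isSOS_iff _).2 (((isSOS_iff _).1 hp).mul ((isSOS_iff _).1 hq))
lemma IsSOS.mul_self {ι : Type*} (p : MvPolynomial ι ℝ) :
    IsSOS (p * p) := (isSOS_iff _).2 (IsSumSq.mul_self p)

lemma isPre_sos {ι : Type*} : IsPre {p : MvPolynomial ι ℝ | IsSOS p} :=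
  ⟨fun _ hx _ hy => IsSOS.add hx hy, fun _ hx _ hy => IsSOS.mul hx hy, IsSOS.mul_self⟩

section preord
variable {ι κ : Type*} [Fintype κ] [DecidableEq κ] (g : κ → MvPolynomial ι ℝ)

lemma InPreordering.zero : InPreordering g 0 := ⟨0, fun _ => IsSOS.zero, by simp⟩

lemma InPreordering.add {p q : MvPolynomial ι ℝ} (hp : InPreordering g p)
    (hq : InPreordering g q) : InPreordering g (p + q) := by
  obtain ⟨c, hc, rfl⟩ := hp
  obtain ⟨d, hd, rfl⟩ := hq
  refine ⟨c + d, fun J => (hc J).add (hd J), ?_⟩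
  rw [← Finset.sum_add_distrib]
  exact Finset.sum_congr rfl fun J _ => by simp [add_mul]

lemma InPreordering.single (J : Finset κ) {s : MvPolynomial ι ℝ} (hs : IsSOS s) :
    InPreordering g (s * ∏ j ∈ J, g j) := by
  refine ⟨fun J' => if J' = J then s else 0, fun J' => ?_, ?_⟩
  · dsimp only; split_ifs; exacts [hs, IsSOS.zero]
  · simp

lemma InPreordering.sum {α : Type*} (S : Finset α) (p : α → MvPolynomial ι ℝ)
    (hp : ∀ a ∈ S, InPreordering g (p a)) : InPreordering g (∑ a ∈ S, p a) :=
  Finset.sum_induction p (InPreordering g) (fun _ _ => InPreordering.add g)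
    (InPreordering.zero g) hp

lemma isPre_preordering : IsPre {p | InPreordering g p} := by
  refine ⟨fun _ hx _ hy => InPreordering.add g hx hy, ?_, ?_⟩
  · rintro _ ⟨c, hc, rfl⟩ _ ⟨d, hd, rfl⟩
    change InPreordering g _
    rw [Finset.sum_mul_sum]
    refine InPreordering.sum g _ _ fun J _ => InPreordering.sum g _ _ fun J' _ => ?_
    have e : (c J * ∏ j ∈ J, g j) * (d J' * ∏ j ∈ J', g j) =
        (c J * d J' * ((∏ j ∈ J ∩ J', g j) * ∏ j ∈ J ∩ J', g j)) *
          ∏ j ∈ symmDiff J J', g j := by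
      have h1 : ∏ j ∈ J, g j = (∏ j ∈ J \ J', g j) * ∏ j ∈ J ∩ J', g j := by
        rw [mul_comm, Finset.prod_inter_mul_prod_sdiff]
      have h2 : ∏ j ∈ J', g j = (∏ j ∈ J' \ J, g j) * ∏ j ∈ J ∩ J', g j := by
        rw [mul_comm, Finset.inter_comm, Finset.prod_inter_mul_prod_sdiff]
      have h3 : ∏ j ∈ symmDiff J J', g j = (∏ j ∈ J \ J', g j) * ∏ j ∈ J' \ J, g j := by
        rw [symmDiff_def, Finset.sup_eq_union, Finset.prod_union]
        exact disjoint_sdiff_sdiff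
      rw [h1, h2, h3]; ring
    rw [e]
    exact InPreordering.single g _ (((hc J).mul (hd J')).mul (IsSOS.mul_self _))
  · intro x
    have := InPreordering.single g ∅ (IsSOS.mul_self x)
    simpa using this

lemma gen_mem_preordering (i : κ) : InPreordering g (g i) := by
  have := InPreordering.single g {i} (IsSOS.mul_self 1)
  simpa using this
end preord

section qm
variable {ι κ : Type*} [Fintype κ] (g : κ → MvPolynomial ι ℝ)

lemma InQuadraticModule.add {p q : MvPolynomial ι ℝ} (hp : InQuadraticModule g p)
    (hq : InQuadraticModule g q) : InQuadraticModule g (p + q) := by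
  obtain ⟨c₀, c, h0, hc, rfl⟩ := hp
  obtain ⟨d₀, d, k0, hd, rfl⟩ := hq
  refine ⟨c₀ + d₀, c + d, h0.add k0, fun J => (hc J).add (hd J), ?_⟩
  simp only [Pi.add_apply, add_mul, Finset.sum_add_distrib]
  ring

lemma InQuadraticModule.sos {p : MvPolynomial ι ℝ} (hp : IsSOS p) : InQuadraticModule g p :=
  ⟨p, 0, hp, fun _ => IsSOS.zero, by simp⟩

lemma InQuadraticModule.sos_mul {p s : MvPolynomial ι ℝ} (hs : IsSOS s)
    (hp : InQuadraticModule g p) : InQuadraticModule g (s * p) := by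
  obtain ⟨c₀, c, h0, hc, rfl⟩ := hp
  refine ⟨s * c₀, fun j => s * c j, hs.mul h0, fun j => hs.mul (hc j), ?_⟩
  rw [mul_add, Finset.mul_sum]
  simp only [mul_assoc]

lemma InQuadraticModule.gen_sum (c : κ → MvPolynomial ι ℝ) (hc : ∀ j, IsSOS (c j)) :
    InQuadraticModule g (∑ j, c j * g j) :=
  ⟨0, c, IsSOS.zero, hc, by simp⟩
end qm

theorem schmudgen {σ κ : Type} [Fintype σ] [Fintype κ] [DecidableEq κ]
    (h : κ → MvPolynomial σ ℝ) (N : ℝ) (hN0 : 0 ≤ N)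
    (hN : ∀ x : σ → ℝ, (∀ i, 0 ≤ eval x (h i)) → ∑ v, x v ^ 2 < N)
    (f : MvPolynomial σ ℝ) (hf : ∀ x, (∀ i, 0 ≤ eval x (h i)) → 0 < eval x f) :
    InPreordering h f :=
  pos_mem (isPre_preordering h) (arch_of_compact (isPre_preordering h) h
    (gen_mem_preordering h) N hN0 hN) h (gen_mem_preordering h) f hf

lemma ball_mem {σ κ : Type} [Fintype σ] [Fintype κ] 
    (g : κ → MvPolynomial σ ℝ) (N : ℝ) (hN : InQuadraticModule g (C N - ∑ v, X v ^ 2))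
    (f : MvPolynomial σ ℝ) (hf : ∀ x : σ → ℝ, ∑ v, x v ^ 2 ≤ N → 0 < eval x f) :
    InQuadraticModule g f := by
  have hpre := (isPre_sos (ι := σ)).adjoin (C N - ∑ v, X v ^ 2)
  have hq : C N - ∑ v, X v ^ 2 ∈ {x | ∃ c ∈ {p : MvPolynomial σ ℝ | IsSOS p},
      ∃ d ∈ {p : MvPolynomial σ ℝ | IsSOS p}, x = c + (C N - ∑ v, X v ^ 2) * d} :=
    ⟨0, isPre_sos.zero, 1, isPre_sos.one, by ring⟩
  have := pos_mem hpre (arch_of_ball hpre N hq) (fun _ : Unit => C N - ∑ v, X v ^ 2) (fun _ => hq)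
    f (fun x hx => hf x (by simpa using hx ()))
  obtain ⟨c, hc, d, hd, rfl⟩ := this
  rw [mul_comm]
  exact (InQuadraticModule.sos g hc).add g (InQuadraticModule.sos_mul g hd hN)

lemma scalar_bound1 (k : ℕ) (G : ℝ) (h0 : 0 ≤ G) (h1 : G ≤ 1) :
    G * (1 - G) ^ (2 * k) ≤ 1 / (2 * k + 1) := by
  have hb := one_add_mul_le_pow (a := G) (by linarith) (2 * k)
  have hp : (1 - G) ^ (2 * k) * (1 + G) ^ (2 * k) ≤ 1 := by
    rw [← mul_pow]
    exact pow_le_one₀ (by nlinarith) (by nlinarith)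
  have hn : 0 ≤ (1 - G) ^ (2 * k) := pow_nonneg (by linarith) _
  have hle1 : (1 - G) ^ (2 * k) ≤ 1 := pow_le_one₀ (by linarith) (by linarith)
  push_cast at hb
  rw [le_div_iff₀ (by positivity)]
  have := mul_le_mul_of_nonneg_left hb hn
  nlinarith

lemma scalar_bound2 (k : ℕ) (G : ℝ) (h0 : G ≤ 0) :
    G * (1 - G) ^ (2 * k) ≤ G * (1 + 2 * k * (-G)) := by
  have hb := one_add_mul_le_pow (a := -G) (by linarith) (2 * k)
  push_cast at hb
  have := mul_le_mul_of_nonpos_left hb h0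
  rw [sub_eq_add_neg]; exact this

theorem putinar {σ κ : Type} [Fintype σ] [Fintype κ]
    (g : κ → MvPolynomial σ ℝ) (N : ℝ) (hN : InQuadraticModule g (C N - ∑ v, X v ^ 2))
    (f : MvPolynomial σ ℝ) (hf : ∀ x, (∀ i, 0 ≤ eval x (g i)) → 0 < eval x f) :
    InQuadraticModule g f := by
  set B : Set (σ → ℝ) := {x | ∑ v, x v ^ 2 ≤ N} with hB
  have hBc : IsCompact B := by
    refine Metric.isCompact_of_isClosed_isBounded ?_ ?_
    · exact isClosed_le (by fun_prop) continuous_const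
    · refine (Metric.isBounded_closedBall (x := (0 : σ → ℝ)) (r := N + 1)).subset ?_
      intro x hx
      have hx' : ∑ v, x v ^ 2 ≤ N := hx
      have hN0 : 0 ≤ N := le_trans (Finset.sum_nonneg fun v _ => sq_nonneg (x v)) hx'
      rw [mem_closedBall_zero_iff, pi_norm_le_iff_of_nonneg (by linarith)]
      intro v
      have := Finset.single_le_sum (f := fun v => x v ^ 2) (fun v _ => sq_nonneg (x v)) (Finset.mem_univ v)
      rw [Real.norm_eq_abs]
      refine abs_le_of_sq_le_sq ?_ (by linarith)
      nlinarith
  have hcont : ∀ p : MvPolynomial σ ℝ, Continuous fun x : σ → ℝ => eval x p := fun p => continuous_eval p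
  -- bound
  have hbd : ∀ p : MvPolynomial σ ℝ, ∃ M : ℝ, 1 ≤ M ∧ ∀ x ∈ B, |eval x p| ≤ M := by
    intro p
    obtain ⟨M, hM⟩ := hBc.exists_bound_of_continuousOn (hcont p).continuousOn
    exact ⟨max M 1, le_max_right _ _, fun x hx => (hM x hx).trans (le_max_left _ _)⟩
  choose M hM1 hM using fun j => hbd (g j)
  obtain ⟨Fm, hFm1, hFm⟩ := hbd f
  set G : κ → (σ → ℝ) → ℝ := fun j x => eval x (g j) / M j with hG
  have hG1 : ∀ j, ∀ x ∈ B, G j x ≤ 1 := fun j x hx =>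
    (div_le_one (by linarith [hM1 j])).2 ((le_abs_self _).trans (hM j x hx))
  have hε : ∃ ε : ℝ, 0 < ε ∧ ∀ x ∈ B, ε ≤ eval x f ∨ ∃ j, G j x ≤ -ε := by
    set Φ : (σ → ℝ) → ℝ := fun x => Finset.univ.sup' (f := fun o : Option κ => o.elim (eval x f) (fun j => - G j x)) Finset.univ_nonempty with hΦ
    have hΦc : Continuous Φ := by
      refine Continuous.finset_sup'_apply _ fun o _ => ?_
      rcases o with _ | j
      · exact hcont f
      · exact ((hcont (g j)).div_const _).neg
    have hΦpos : ∀ x, 0 < Φ x := by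
      intro x
      rw [hΦ]; refine (Finset.lt_sup'_iff _).2 ?_
      by_cases h : ∀ i, 0 ≤ eval x (g i)
      · exact ⟨none, Finset.mem_univ _, hf x h⟩
      · push Not at h
        obtain ⟨j, hj⟩ := h
        refine ⟨some j, Finset.mem_univ _, ?_⟩
        have : G j x < 0 := div_neg_of_neg_of_pos hj (by linarith [hM1 j])
        simpa using this
    rcases B.eq_empty_or_nonempty with hem | hne
    · exact ⟨1, one_pos, fun x hx => by rw [hem] at hx; exact absurd hx (by simp)⟩
    obtain ⟨x₀, hx₀, hmin⟩ := hBc.exists_isMinOn hne hΦc.continuousOn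
    refine ⟨Φ x₀, hΦpos x₀, fun x hx => ?_⟩
    have h1 : Φ x₀ ≤ Φ x := hmin hx
    rw [hΦ] at h1
    obtain ⟨o, _, ho⟩ := (Finset.le_sup'_iff _).1 h1
    rcases o with _ | j
    · exact Or.inl ho
    · right; refine ⟨j, ?_⟩
      have ho' : Φ x₀ ≤ - G j x := ho
      linarith
  obtain ⟨ε, hε0, hε⟩ := hε
  set a : ℝ := (Fintype.card κ : ℝ) with ha
  obtain ⟨k, hk⟩ : ∃ k : ℕ, a / ε < k ∧ Fm / (ε * ε) < k := by
    obtain ⟨k, hk⟩ := exists_nat_gt (max (a / ε) (Fm / (ε * ε)))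
    exact ⟨k, max_lt_iff.1 hk⟩
  have hk1 : a / (2 * k + 1) < ε := by
    rw [div_lt_iff₀ (by positivity)]
    have := (div_lt_iff₀ hε0).1 hk.1
    nlinarith
  have hk2 : Fm < k * (ε * ε) := (div_lt_iff₀ (by positivity)).1 hk.2
  set c : κ → MvPolynomial σ ℝ := fun j =>
    C (1 / M j) * ((1 - C (1 / M j) * g j) ^ k * (1 - C (1 / M j) * g j) ^ k) with hc
  have hcs : ∀ j, IsSOS (c j) := fun j =>
    IsSOS.mul (isPre_sos.const _ (by have := hM1 j; positivity)) (IsSOS.mul_self _)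
  have hev : ∀ x, eval x (∑ j, c j * g j) = ∑ j, G j x * (1 - G j x) ^ (2 * k) := by
    intro x
    rw [map_sum]
    refine Finset.sum_congr rfl fun j _ => ?_
    simp only [hc, hG, map_mul, map_pow, map_sub, map_one, eval_C]
    rw [two_mul, pow_add]
    simp only [div_eq_mul_inv, one_mul, mul_comm (M j)⁻¹]
    ring
  have hmain : InQuadraticModule g (f - ∑ j, c j * g j) := by
    refine ball_mem g N hN _ fun x hx => ?_
    rw [map_sub, hev, sub_pos]
    have hterm : ∀ j, G j x * (1 - G j x) ^ (2 * k) ≤ 1 / (2 * k + 1) := by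
      intro j
      rcases le_total 0 (G j x) with h | h
      · exact scalar_bound1 k _ h (hG1 j x hx)
      · refine le_trans (mul_nonpos_of_nonpos_of_nonneg h (pow_nonneg (by linarith) _)) (by positivity)
    rcases hε x hx with h | ⟨j, hj⟩
    · calc _ ≤ ∑ j : κ, 1 / (2 * (k:ℝ) + 1) := Finset.sum_le_sum fun j _ => hterm j
        _ = a / (2 * k + 1) := by simp [ha, div_eq_mul_inv]
        _ < ε := hk1
        _ ≤ _ := h
    · classical
      have hlo : -Fm ≤ eval x f := (abs_le.1 (hFm x hx)).1
      have hj2 : G j x * (1 - G j x) ^ (2 * k) ≤ -(k * (ε * ε)) - ε := by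
        refine (scalar_bound2 k _ (by linarith)).trans ?_
        have h3 : ε * ε ≤ G j x * G j x := by nlinarith
        have h4 := mul_le_mul_of_nonneg_left h3 (Nat.cast_nonneg (α := ℝ) k)
        nlinarith
      have hrest : ∑ i ∈ Finset.univ.erase j, G i x * (1 - G i x) ^ (2 * k) ≤ a / (2 * k + 1) := by
        calc _ ≤ ∑ i ∈ Finset.univ.erase j, 1 / (2 * (k:ℝ) + 1) := Finset.sum_le_sum fun j _ => hterm j
          _ ≤ ∑ i : κ, 1 / (2 * (k:ℝ) + 1) :=
            Finset.sum_le_sum_of_subset_of_nonneg (Finset.subset_univ _) fun _ _ _ => by positivity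
          _ = a / (2 * k + 1) := by simp [ha, div_eq_mul_inv]
      rw [← Finset.add_sum_erase _ _ (Finset.mem_univ j)]
      linarith
  have := hmain.add g (InQuadraticModule.gen_sum g c hcs)
  simpa using this
end part9

open MvPolynomial

open Topology in
lemma sep_cont {X E Z : Type*} [TopologicalSpace X] [NormedAddCommGroup E] [NormedSpace ℝ E]
    [FiniteDimensional ℝ E] [TopologicalSpace Z]
    (A : Set (X × E)) (B : Set (E × Z)) (hA : IsCompact A) (hB : IsCompact B)
    (u : X × E → ℝ) (v : E × Z → ℝ) (hu : Continuous u) (hv : Continuous v)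
    (huv : ∀ x y z, (x, y) ∈ A → (y, z) ∈ B → v (y, z) < u (x, y)) :
    ∃ φ : C(E, ℝ), (∀ w ∈ A, φ w.2 < u w) ∧ ∀ w ∈ B, v w < φ w.1 := by
  have := FiniteDimensional.proper_real E
  obtain ⟨φ, hφ⟩ := exists_continuous_forall_mem_convex_of_local_const
    (t := fun y : E => {c : ℝ | (∀ x, (x, y) ∈ A → c < u (x, y)) ∧ ∀ z, (y, z) ∈ B → v (y, z) < c})
    (by
      intro y a ha b hb s t hs ht hst
      refine ⟨fun x hx => ?_, fun z hz => ?_⟩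
      · have h1 := ha.1 x hx
        have h2 := hb.1 x hx
        simp only [smul_eq_mul]
        have : s * (u (x, y) - a) + t * (u (x, y) - b) > 0 := by
          rcases hs.eq_or_lt with h | h
          · have : t = 1 := by linarith
            subst this; rw [← h]; simp; linarith
          · have := mul_pos h (sub_pos.2 h1)
            have := mul_nonneg ht (sub_pos.2 h2).le
            linarith
        have ht' : t = 1 - s := by linarith
        subst ht'
        linarith
      · have h1 := ha.2 z hz
        have h2 := hb.2 z hz
        simp only [smul_eq_mul]
        have : s * (a - v (y, z)) + t * (b - v (y, z)) > 0 := by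
          rcases hs.eq_or_lt with h | h
          · have : t = 1 := by linarith
            subst this; rw [← h]; simp; linarith
          · have := mul_pos h (sub_pos.2 h1)
            have := mul_nonneg ht (sub_pos.2 h2).le
            linarith
        have ht' : t = 1 - s := by linarith
        subst ht'
        linarith)
    (by
      intro y₀
      have hc : ∃ c : ℝ, (∀ x, (x, y₀) ∈ A → c < u (x, y₀)) ∧ ∀ z, (y₀, z) ∈ B → v (y₀, z) < c := by
        have hA' : IsCompact (A ∩ Prod.snd ⁻¹' {y₀}) :=
          hA.inter_right (isClosed_singleton.preimage continuous_snd)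
        have hB' : IsCompact (B ∩ Prod.fst ⁻¹' {y₀}) :=
          hB.inter_right (isClosed_singleton.preimage continuous_fst)
        rcases (A ∩ Prod.snd ⁻¹' {y₀}).eq_empty_or_nonempty with hAe | hAn
        · obtain ⟨M, hM⟩ := hB'.bddAbove_image hv.continuousOn
          refine ⟨M + 1, fun x hx => ?_, fun z hz => ?_⟩
          · have : (x, y₀) ∈ A ∩ Prod.snd ⁻¹' {y₀} := ⟨hx, rfl⟩
            rw [hAe] at this; exact absurd this (by simp)
          · have := hM ⟨(y₀, z), ⟨hz, rfl⟩, rfl⟩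
            linarith
        · obtain ⟨⟨x₁, y₁⟩, ⟨hx₁, rfl⟩, hmin⟩ := hA'.exists_isMinOn hAn hu.continuousOn
          rcases (B ∩ Prod.fst ⁻¹' {y₁}).eq_empty_or_nonempty with hBe | hBn
          · refine ⟨u (x₁, y₁) - 1, fun x hx => ?_, fun z hz => ?_⟩
            · have : u (x₁, y₁) ≤ u (x, y₁) := hmin ⟨hx, rfl⟩
              linarith
            · have : (y₁, z) ∈ B ∩ Prod.fst ⁻¹' {y₁} := ⟨hz, rfl⟩
              rw [hBe] at this; exact absurd this (by simp)
          · obtain ⟨⟨y₂, z₂⟩, ⟨hz₂, rfl⟩, hmax⟩ := hB'.exists_isMaxOn hBn hv.continuousOn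
            have hlt := huv _ _ _ hx₁ hz₂
            refine ⟨(u (x₁, y₂) + v (y₂, z₂)) / 2, fun x hx => ?_, fun z hz => ?_⟩
            · have : u (x₁, y₂) ≤ u (x, y₂) := hmin ⟨hx, rfl⟩
              linarith
            · have : v (y₂, z) ≤ v (y₂, z₂) := hmax ⟨hz, rfl⟩
              linarith
      obtain ⟨c, hc1, hc2⟩ := hc
      refine ⟨c, ?_⟩
      have hcl1 : IsClosed (Prod.snd '' (A ∩ {w | u w ≤ c})) :=
        ((hA.inter_right (isClosed_le hu continuous_const)).image continuous_snd).isClosed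
      have hcl2 : IsClosed (Prod.fst '' (B ∩ {w | c ≤ v w})) :=
        ((hB.inter_right (isClosed_le continuous_const hv)).image continuous_fst).isClosed
      have n1 : y₀ ∉ Prod.snd '' (A ∩ {w | u w ≤ c}) := by
        rintro ⟨⟨x, y⟩, ⟨hx, h⟩, rfl⟩
        exact absurd (hc1 x hx) (not_lt.2 h)
      have n2 : y₀ ∉ Prod.fst '' (B ∩ {w | c ≤ v w}) := by
        rintro ⟨⟨x, y⟩, ⟨hx, h⟩, rfl⟩
        exact absurd (hc2 y hx) (not_lt.2 h)
      filter_upwards [hcl1.isOpen_compl.mem_nhds n1, hcl2.isOpen_compl.mem_nhds n2] with y h1 h2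
      refine ⟨fun x hx => ?_, fun z hz => ?_⟩
      · by_contra hcon
        exact h1 ⟨(x, y), ⟨hx, not_lt.1 hcon⟩, rfl⟩
      · by_contra hcon
        exact h2 ⟨(y, z), ⟨hz, not_lt.1 hcon⟩, rfl⟩)
  exact ⟨φ, fun w hw => (hφ w.2).1 w.1 hw, fun w hw => (hφ w.1).2 w.2 hw⟩

lemma poly_approx {m : ℕ} (D : Set (Fin m → ℝ)) (hD : IsCompact D) (φ : C(Fin m → ℝ, ℝ))
    (ε : ℝ) (hε : 0 < ε) : ∃ q : MvPolynomial (Fin m) ℝ, ∀ y ∈ D, |eval y q - φ y| < ε := by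
  let Ψ : MvPolynomial (Fin m) ℝ →ₐ[ℝ] C(Fin m → ℝ, ℝ) :=
    aeval (fun i => (⟨fun y => y i, continuous_apply i⟩ : C(Fin m → ℝ, ℝ)))
  have hΨ : ∀ q y, Ψ q y = eval y q := by
    intro q y
    induction q using MvPolynomial.induction_on with
    | C a => simp [Ψ]
    | add p q hp hq => simp [hp, hq]
    | mul_X p v hp => simp [hp]; left; simp [Ψ]
  have hsep : Ψ.range.SeparatesPoints := by
    intro x y hxy
    obtain ⟨i, hi⟩ := Function.ne_iff.1 hxy
    refine ⟨_, ⟨Ψ (X i), ⟨X i, rfl⟩, rfl⟩, ?_⟩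
    change Ψ (X i) x ≠ Ψ (X i) y
    rw [hΨ, hΨ]; simpa using hi
  obtain ⟨_, ⟨q, rfl⟩, hg⟩ :=
    ContinuousMap.exists_mem_subalgebra_near_continuous_of_isCompact_of_separatesPoints hsep φ hD hε
  refine ⟨q, fun y hy => ?_⟩
  have := hg y hy
  rw [← hΨ]
  exact this

lemma margin {W : Type*} [TopologicalSpace W] (A : Set W) (hA : IsCompact A) (u : W → ℝ)
    (hu : Continuous u) (hpos : ∀ w ∈ A, 0 < u w) : ∃ ε : ℝ, 0 < ε ∧ ∀ w ∈ A, ε ≤ u w := by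
  rcases A.eq_empty_or_nonempty with h | h
  · exact ⟨1, one_pos, by simp [h]⟩
  · obtain ⟨w, hw, hmin⟩ := hA.exists_isMinOn h hu.continuousOn
    exact ⟨u w, hpos w hw, fun w' hw' => hmin hw'⟩

theorem specialized_putinar_left
    (n m p a b : ℕ)
    (g : Fin a → MvPolynomial (Fin n ⊕ Fin m) ℝ)
    (h : Fin b → MvPolynomial (Fin m ⊕ Fin p) ℝ)
    (Kxy : Set ((Fin n → ℝ) × (Fin m → ℝ)))
    (Kyz : Set ((Fin m → ℝ) × (Fin p → ℝ)))
    (K : Set ((Fin n → ℝ) × (Fin m → ℝ) × (Fin p → ℝ)))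
    (hKxy : Kxy = {w | ∀ j, 0 ≤ eval (Sum.elim w.1 w.2) (g j)})
    (hKyz : Kyz = {w | ∀ k, 0 ≤ eval (Sum.elim w.1 w.2) (h k)})
    (hK : K = {w | (w.1, w.2.1) ∈ Kxy ∧ w.2 ∈ Kyz})
    (hKxyCompact : IsCompact Kxy) (hKyzCompact : IsCompact Kyz)
    (hKint : (interior K).Nonempty)
    (N : ℝ)
    (hN : InQuadraticModule g (C N - ∑ v : Fin n ⊕ Fin m, X v ^ 2))
    (f : MvPolynomial (Fin n ⊕ Fin m ⊕ Fin p) ℝ)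
    (f₁ : MvPolynomial (Fin n ⊕ Fin m) ℝ) (f₂ : MvPolynomial (Fin m ⊕ Fin p) ℝ)
    (hf : f = rename (Sum.map id Sum.inl) f₁ + rename Sum.inr f₂)
    (hpos : ∀ w ∈ K, 0 < eval (Sum.elim w.1 (Sum.elim w.2.1 w.2.2)) f) :
    ∃ (σ : MvPolynomial (Fin n ⊕ Fin m) ℝ) (ψ : MvPolynomial (Fin m ⊕ Fin p) ℝ),
      InQuadraticModule g σ ∧ InPreordering h ψ ∧
      f = rename (Sum.map id Sum.inl) σ + rename Sum.inr ψ := by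
  have hcont₁ : Continuous fun w : (Fin n → ℝ) × (Fin m → ℝ) => eval (Sum.elim w.1 w.2) f₁ := by
    refine (continuous_eval f₁).comp (continuous_pi fun i => ?_)
    rcases i with i | i
    · exact (continuous_apply i).comp continuous_fst
    · exact (continuous_apply i).comp continuous_snd
  have hcont₂ : Continuous fun w : (Fin m → ℝ) × (Fin p → ℝ) => eval (Sum.elim w.1 w.2) f₂ := by
    refine (continuous_eval f₂).comp (continuous_pi fun i => ?_)
    rcases i with i | i
    · exact (continuous_apply i).comp continuous_fst
    · exact (continuous_apply i).comp continuous_snd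
  obtain ⟨φ, hφ₁, hφ₂⟩ := sep_cont Kxy Kyz hKxyCompact hKyzCompact
    (fun w => eval (Sum.elim w.1 w.2) f₁) (fun w => - eval (Sum.elim w.1 w.2) f₂)
    hcont₁ hcont₂.neg (by
      intro x y z hx hz
      have h1 := hpos (x, y, z) (by rw [hK]; exact ⟨hx, hz⟩)
      rw [hf, map_add, eval_rename, eval_rename] at h1
      have e1 : (Sum.elim x (Sum.elim y z)) ∘ (Sum.map id Sum.inl : Fin n ⊕ Fin m → Fin n ⊕ Fin m ⊕ Fin p) =
          Sum.elim x y := by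
        ext i; rcases i with i | i <;> rfl
      have e2 : (Sum.elim x (Sum.elim y z)) ∘ (Sum.inr : Fin m ⊕ Fin p → Fin n ⊕ Fin m ⊕ Fin p) =
          Sum.elim y z := by
        ext i; rcases i with i | i <;> rfl
      simp only [e1, e2] at h1
      change - eval (Sum.elim y z) f₂ < eval (Sum.elim x y) f₁
      linarith)
  obtain ⟨ε₁, hε₁, hm₁⟩ := margin Kxy hKxyCompact
    (fun w => eval (Sum.elim w.1 w.2) f₁ - φ w.2)
    (hcont₁.sub (φ.continuous.comp continuous_snd)) (fun w hw => sub_pos.2 (hφ₁ w hw))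
  obtain ⟨ε₂, hε₂, hm₂⟩ := margin Kyz hKyzCompact
    (fun w => φ w.1 - - eval (Sum.elim w.1 w.2) f₂)
    ((φ.continuous.comp continuous_fst).sub hcont₂.neg) (fun w hw => sub_pos.2 (hφ₂ w hw))
  obtain ⟨q, hq⟩ := poly_approx (Prod.snd '' Kxy ∪ Prod.fst '' Kyz)
    ((hKxyCompact.image continuous_snd).union (hKyzCompact.image continuous_fst)) φ
    (min ε₁ ε₂) (lt_min hε₁ hε₂)
  have hsplit : ∀ {s t : ℕ} (x : Fin s ⊕ Fin t → ℝ),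
      Sum.elim (fun i => x (Sum.inl i)) (fun i => x (Sum.inr i)) = x := by
    intro s t x
    ext i; rcases i with i | i <;> rfl
  obtain ⟨R, hR0, hR⟩ : ∃ R : ℝ, 0 ≤ R ∧ ∀ x : Fin m ⊕ Fin p → ℝ,
      (∀ i, 0 ≤ eval x (h i)) → ∑ v, x v ^ 2 < R := by
    have hc : Continuous fun w : (Fin m → ℝ) × (Fin p → ℝ) =>
        ∑ v, (Sum.elim w.1 w.2 v) ^ 2 := by
      refine continuous_finsetSum _ fun i _ => Continuous.pow ?_ 2
      rcases i with i | i
      · exact (continuous_apply i).comp continuous_fst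
      · exact (continuous_apply i).comp continuous_snd
    obtain ⟨M, hM⟩ := hKyzCompact.bddAbove_image hc.continuousOn
    refine ⟨max M 0 + 1, by positivity, fun x hx => ?_⟩
    have hmem : ((fun i => x (Sum.inl i), fun i => x (Sum.inr i)) : (Fin m → ℝ) × (Fin p → ℝ)) ∈ Kyz := by
      rw [hKyz]
      intro k
      have := hx k
      simpa only [hsplit] using this
    have h1 := hM ⟨_, hmem, rfl⟩
    simp only [hsplit] at h1
    have := le_max_left M 0
    linarith
  refine ⟨f₁ - rename Sum.inr q, f₂ + rename Sum.inl q, ?_, ?_, ?_⟩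
  · refine putinar g N hN _ fun x hx => ?_
    have hmem : ((fun i => x (Sum.inl i), fun i => x (Sum.inr i)) : (Fin n → ℝ) × (Fin m → ℝ)) ∈ Kxy := by
      rw [hKxy]
      intro k
      have := hx k
      simpa only [hsplit] using this
    have h1 := hm₁ _ hmem
    simp only [hsplit] at h1
    have h2 := hq (fun i => x (Sum.inr i)) (Or.inl ⟨_, hmem, rfl⟩)
    have h3 := (abs_lt.1 h2).2
    rw [map_sub, eval_rename]
    change 0 < eval x f₁ - eval (fun i => x (Sum.inr i)) q
    have := min_le_left ε₁ ε₂
    linarith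
  · refine schmudgen h R hR0 hR _ fun x hx => ?_
    have hmem : ((fun i => x (Sum.inl i), fun i => x (Sum.inr i)) : (Fin m → ℝ) × (Fin p → ℝ)) ∈ Kyz := by
      rw [hKyz]
      intro k
      have := hx k
      simpa only [hsplit] using this
    have h1 := hm₂ _ hmem
    simp only [hsplit] at h1
    have h2 := hq (fun i => x (Sum.inl i)) (Or.inr ⟨_, hmem, rfl⟩)
    have h3 := (abs_lt.1 h2).1
    rw [map_add, eval_rename]
    change 0 < eval x f₂ + eval (fun i => x (Sum.inl i)) q
    have := min_le_right ε₁ ε₂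
    linarith
  · rw [hf, map_sub, map_add, rename_rename, rename_rename]
    have : (Sum.map id Sum.inl : Fin n ⊕ Fin m → Fin n ⊕ Fin m ⊕ Fin p) ∘ Sum.inr =
        Sum.inr ∘ Sum.inl := rfl
    rw [this]
    ring
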